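/- Let A = D + A' be the self-adjoint band operator as above. Suppose a_l(n) = c_l n^{δ_l} + O(n^{δ−1}) with δ ≥ max{δ_1,…,δ_m}, and d(n) = c₀ n^{δ₀} + c n^{δ₀−1} + O(n^{δ₀−2}) with δ₀ > 0, c₀ > 0, c ∈ ℝ. If κ := δ₀ − δ > 0, then λ_n(A) = d(n) + O(n^{δ−κ}) as n → ∞. -/

import Mathlib

open Filter

/- l²(ℕ*) is modeled as `lp (fun _ : ℕ => ℂ) 2` (index j ↔ paper index j+1;
the paper's convention "a_l(j-l) = 0, x(j-l) = 0 for j ≤ l" becomes the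
`if l ≤ j` guards below). -/

/-- the off-diagonal band operator `A'`. -/
noncomputable def offDiagOp (m : ℕ) (a : ℕ → ℕ → ℝ) (x : ℕ → ℂ) (j : ℕ) : ℂ :=
  ∑ l ∈ Finset.Icc 1 m, ((a l j : ℂ) * x (j + l) +
    if l ≤ j then (a l (j - l) : ℂ) * x (j - l) else 0)

/-- the full band operator `A = D + A'`. -/
noncomputable def bandOp (m : ℕ) (d : ℕ → ℝ) (a : ℕ → ℕ → ℝ) (x : ℕ → ℂ) (j : ℕ) : ℂ :=
  (d j : ℂ) * x j + offDiagOp m a x j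

/-- `lam` is the nondecreasing enumeration (with multiplicity) of the eigenvalues
of the self-adjoint operator `A = D + A'` with compact resolvent: there is an
orthonormal basis `(v n)` of `l²` with `A (v n) = lam n • v n` and `lam n → ∞`,
`lam` nondecreasing. -/
def IsEigenSystem (m : ℕ) (d : ℕ → ℝ) (a : ℕ → ℕ → ℝ)
    (lam : ℕ → ℝ) (v : ℕ → lp (fun _ : ℕ => ℂ) 2) : Prop :=
  Orthonormal ℂ v ∧
  (Submodule.span ℂ (Set.range v)).topologicalClosure = ⊤ ∧
  Monotone lam ∧ Tendsto lam atTop atTop ∧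
  ∀ n j, bandOp m d a ((v n : lp (fun _ : ℕ => ℂ) 2) : ∀ _ : ℕ, ℂ) j
    = (lam n : ℂ) * (v n : ∀ _ : ℕ, ℂ) j

/-- the standing assumptions on `A = D + A'`: the relative decay condition
(|a_l(j-l)|+|a_l(j)|)/d(j) → 0 ensuring self-adjointness, and d(n) → ∞
ensuring compactness of the resolvent. -/
def StandingAssumptions (m : ℕ) (d : ℕ → ℝ) (a : ℕ → ℕ → ℝ) : Prop :=
  (∀ l ∈ Finset.Icc 1 m, Tendsto
    (fun j => ((if l ≤ j then |a l (j - l)| else 0) + |a l j|) / d j) atTop (nhds 0)) ∧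
  Tendsto d atTop atTop

open Filter

lemma schur_bd {ι : Type*} [Fintype ι] (K : ι → ι → ℝ) (g : ι → ℝ) (C : ℝ)
    (hs : ∀ i j, |K i j| = |K j i|) (hr : ∀ i, ∑ j, |K i j| ≤ C * g i) (x : ι → ℝ) :
    |∑ i, ∑ j, K i j * x i * x j| ≤ C * ∑ i, g i * x i ^ 2 := by
  have h1 : |∑ i, ∑ j, K i j * x i * x j| ≤ ∑ i, ∑ j, (|K i j| * x i ^ 2 / 2 + |K i j| * x j ^ 2 / 2) := by
    refine (Finset.abs_sum_le_sum_abs _ _).trans (Finset.sum_le_sum fun i _ => ?_)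
    refine (Finset.abs_sum_le_sum_abs _ _).trans (Finset.sum_le_sum fun j _ => ?_)
    rw [abs_mul, abs_mul]
    have h2 := two_mul_le_add_sq |x i| |x j|
    rw [sq_abs, sq_abs] at h2
    nlinarith [abs_nonneg (K i j)]
  have h3 : ∑ i, ∑ j, |K i j| * x j ^ 2 / 2 = ∑ i, ∑ j, |K i j| * x i ^ 2 / 2 := by
    rw [Finset.sum_comm]
    refine Finset.sum_congr rfl fun i _ => Finset.sum_congr rfl fun j _ => ?_
    rw [hs]
  simp only [Finset.sum_add_distrib] at h1
  rw [h3] at h1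
  refine h1.trans ?_
  rw [← Finset.sum_add_distrib, Finset.mul_sum]
  refine Finset.sum_le_sum fun i _ => ?_
  rw [← Finset.sum_add_distrib]
  have : ∑ j, (|K i j| * x i ^ 2 / 2 + |K i j| * x i ^ 2 / 2) = (∑ j, |K i j|) * x i ^ 2 := by
    rw [Finset.sum_mul]; exact Finset.sum_congr rfl fun j _ => by ring
  rw [this, ← mul_assoc]
  exact mul_le_mul_of_nonneg_right (hr i) (sq_nonneg _)

lemma flow_exists {ι : Type*} [Fintype ι] [DecidableEq ι] (β : ι → ι → ℝ) :
    ∃ X : ℝ → ((ι → ℝ) →L[ℝ] (ι → ℝ)), X 0 = 1 ∧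
      ∀ y i t, HasDerivAt (fun t => X t y i) (∑ k, β i k * X t y k) t := by
  let B : (ι → ℝ) →L[ℝ] (ι → ℝ) := (Matrix.toLin' (Matrix.of β)).toContinuousLinearMap
  refine ⟨fun t => NormedSpace.exp (t • B), by simp, fun y i t => ?_⟩
  have h := hasDerivAt_exp_smul_const' (𝕂 := ℝ) B t
  have h2 := (h.clm_apply (hasDerivAt_const t y))
  rw [hasDerivAt_pi] at h2
  have h3 := h2 i
  refine HasDerivAt.congr_deriv h3 ?_
  simp [B, Matrix.mulVec, dotProduct]

lemma flow_diag {ι : Type*} [Fintype ι] (β : ι → ι → ℝ) (hβ : ∀ i j, β i j = - β j i)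
    (x : ℝ → ι → ℝ) (hx : ∀ i t, HasDerivAt (fun t => x t i) (∑ k, β i k * x t k) t)
    (G : ι → ℝ) (t : ℝ) :
    HasDerivAt (fun t => ∑ i, G i * x t i ^ 2)
      (∑ i, ∑ j, (β i j * (G i - G j)) * x t i * x t j) t := by
  have h : HasDerivAt (fun t => ∑ i, G i * x t i ^ 2)
      (∑ i, G i * (2 * x t i * ∑ k, β i k * x t k)) t := by
    refine HasDerivAt.fun_sum fun i _ => ?_
    have := ((hx i t).fun_pow 2).const_mul (G i)
    simpa using this
  convert h using 1
  have h1 : ∑ i, ∑ j, (β i j * (G i - G j)) * x t i * x t j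
      = ∑ i, ∑ j, β i j * G i * x t i * x t j - ∑ i, ∑ j, β i j * G j * x t i * x t j := by
    simp only [← Finset.sum_sub_distrib]
    exact Finset.sum_congr rfl fun i _ => Finset.sum_congr rfl fun j _ => by ring
  have h2 : ∑ i, ∑ j, β i j * G j * x t i * x t j = - ∑ i, ∑ j, β i j * G i * x t i * x t j := by
    rw [Finset.sum_comm, ← Finset.sum_neg_distrib]
    refine Finset.sum_congr rfl fun i _ => ?_
    rw [← Finset.sum_neg_distrib]
    exact Finset.sum_congr rfl fun j _ => by rw [hβ j i]; ring
  rw [h1, h2, sub_neg_eq_add, ← Finset.sum_add_distrib]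
  refine Finset.sum_congr rfl fun i _ => ?_
  rw [← Finset.sum_add_distrib, Finset.mul_sum, Finset.mul_sum]
  exact Finset.sum_congr rfl fun j _ => by ring

lemma flow_quad {ι : Type*} [Fintype ι] (β α : ι → ι → ℝ) (hβ : ∀ i j, β i j = - β j i)
    
    (x : ℝ → ι → ℝ) (hx : ∀ i t, HasDerivAt (fun t => x t i) (∑ k, β i k * x t k) t) (t : ℝ) :
    HasDerivAt (fun t => ∑ i, ∑ j, α i j * x t i * x t j)
      (∑ i, ∑ j, (∑ k, (α i k * β k j - β i k * α k j)) * x t i * x t j) t := by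
  have h : HasDerivAt (fun t => ∑ i, ∑ j, α i j * x t i * x t j)
      (∑ i, ∑ j, (α i j * (∑ k, β i k * x t k) * x t j + α i j * x t i * (∑ k, β j k * x t k))) t := by
    refine HasDerivAt.fun_sum fun i _ => HasDerivAt.fun_sum fun j _ => ?_
    exact (((hx i t).const_mul (α i j)).mul (hx j t))
  convert h using 1
  simp only [Finset.sum_add_distrib, Finset.mul_sum, Finset.sum_mul, Finset.sum_sub_distrib, sub_mul]
  rw [sub_eq_neg_add]
  congr 1
  · rw [Finset.sum_comm, ← Finset.sum_neg_distrib]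
    calc _ = ∑ j, ∑ k, ∑ i, (- (β i k * α k j * x t i * x t j)) := by
            refine Finset.sum_congr rfl fun j _ => ?_
            rw [Finset.sum_comm, ← Finset.sum_neg_distrib]
            refine Finset.sum_congr rfl fun k _ => by rw [Finset.sum_neg_distrib]
      _ = _ := by
            rw [Finset.sum_comm]
            refine Finset.sum_congr rfl fun k _ => Finset.sum_congr rfl fun j _ =>
              Finset.sum_congr rfl fun i _ => ?_
            rw [hβ i k]; ring
  · refine Finset.sum_congr rfl fun i _ => ?_
    rw [Finset.sum_comm]
    refine Finset.sum_congr rfl fun k _ => Finset.sum_congr rfl fun j _ => by ring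

lemma gron (g g' : ℝ → ℝ) (C : ℝ) (hg : ∀ t, HasDerivAt g (g' t) t) (hb : ∀ t, |g' t| ≤ C * g t)
    (t : ℝ) (ht : 0 ≤ t) : g t ≤ Real.exp (C * t) * g 0 := by
  have hd : ∀ s, HasDerivAt (fun s => Real.exp (-(C * s)) * g s)
      (Real.exp (-(C * s)) * (-C) * g s + Real.exp (-(C * s)) * g' s) s := by
    intro s
    have h1 : HasDerivAt (fun s => -(C * s)) (-C) s := by
      simpa using ((hasDerivAt_id s).const_mul C).fun_neg
    exact h1.exp.mul (hg s)
  have ha : Antitone (fun s => Real.exp (-(C * s)) * g s) := by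
    refine antitone_of_hasDerivAt_nonpos hd fun s => ?_
    have := (abs_le.1 (hb s)).2
    have h2 := Real.exp_pos (-(C * s))
    have : Real.exp (-(C * s)) * (-C) * g s + Real.exp (-(C * s)) * g' s
      = Real.exp (-(C * s)) * (g' s - C * g s) := by ring
    rw [this]
    exact mul_nonpos_of_nonneg_of_nonpos h2.le (by linarith)
  have h := ha ht
  simp only [mul_zero, neg_zero, Real.exp_zero, one_mul] at h
  rw [Real.exp_neg, inv_mul_le_iff₀ (Real.exp_pos _)] at h
  exact h

lemma flow_main {ι : Type*} [Fintype ι] [DecidableEq ι] (α β : ι → ι → ℝ) (d g h : ι → ℝ) (C : ℝ)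
    (hC : 0 ≤ C)
    (hβ : ∀ i j, β i j = - β j i) (hα : ∀ i j, α i j = α j i)
    (hg0 : ∀ i, 0 ≤ g i)
    (h1 : ∀ i, ∑ j, |α i j + β i j * (d i - d j)| ≤ C * g i)
    (h2 : ∀ i, ∑ j, |∑ k, (α i k * β k j - β i k * α k j)| ≤ C * g i)
    (h3 : ∀ i, ∑ j, |β i j * (g i - g j)| ≤ C * g i)
    (h4 : ∀ i, ∑ j, |β i j * (h i - h j)| ≤ C * h i) :
    ∃ U : (ι → ℝ) ≃ₗ[ℝ] (ι → ℝ), ∀ y, (∑ i, U y i ^ 2 = ∑ i, y i ^ 2) ∧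
      |∑ i, d i * U y i ^ 2 + ∑ i, ∑ j, α i j * U y i * U y j - ∑ i, d i * y i ^ 2|
        ≤ 2 * C * Real.exp C * ∑ i, g i * y i ^ 2 ∧
      ∑ i, h i * U y i ^ 2 ≤ Real.exp C * ∑ i, h i * y i ^ 2 := by
  obtain ⟨X, hX0, hX⟩ := flow_exists β
  have hiso : ∀ y t, ∑ i, X t y i ^ 2 = ∑ i, y i ^ 2 := by
    intro y t
    have hd : ∀ t, HasDerivAt (fun t => ∑ i, X t y i ^ 2) 0 t := by
      intro t
      have := flow_diag β hβ (fun t => X t y) (hX y) (fun _ => 1) t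
      simpa using this
    have := is_const_of_deriv_eq_zero (fun t => (hd t).differentiableAt) (fun t => (hd t).deriv) t 0
    simpa [hX0] using this
  have hinj : Function.Injective (X 1) := by
    rw [injective_iff_map_eq_zero]
    intro y hy
    have := hiso y 1
    rw [hy] at this
    simp only [Pi.zero_apply, ne_eq, OfNat.ofNat_ne_zero, not_false_eq_true, zero_pow,
      Finset.sum_const_zero] at this
    have h' := (Finset.sum_eq_zero_iff_of_nonneg (fun i _ => sq_nonneg (y i))).1 this.symm
    funext i
    exact pow_eq_zero_iff (two_ne_zero) |>.1 (h' i (Finset.mem_univ _))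
  let U := LinearEquiv.ofInjectiveEndo (X 1 : (ι → ℝ) →ₗ[ℝ] (ι → ℝ)) hinj
  refine ⟨U, fun y => ?_⟩
  have hU : U y = X 1 y := rfl
  rw [hU]
  have hgr : ∀ (G : ι → ℝ), (∀ i, ∑ j, |β i j * (G i - G j)| ≤ C * G i) → ∀ t, 0 ≤ t →
      ∑ i, G i * X t y i ^ 2 ≤ Real.exp (C * t) * ∑ i, G i * y i ^ 2 := by
    intro G hG t ht
    have := gron (fun t => ∑ i, G i * X t y i ^ 2) _ C
      (flow_diag β hβ (fun t => X t y) (hX y) G) (fun t => ?_) t ht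
    · simpa [hX0] using this
    · refine schur_bd _ G C (fun i j => ?_) hG _
      rw [hβ i j]; congr 1; ring
  refine ⟨hiso y 1, ?_, by simpa using hgr h h4 1 zero_le_one⟩
  have hgy : 0 ≤ ∑ i, g i * y i ^ 2 := Finset.sum_nonneg fun i _ => mul_nonneg (hg0 i) (sq_nonneg _)
  have hder : ∀ t, HasDerivAt (fun t => ∑ i, d i * X t y i ^ 2 + t * ∑ i, ∑ j, α i j * X t y i * X t y j)
      (∑ i, ∑ j, (α i j + β i j * (d i - d j)) * X t y i * X t y j
        + t * ∑ i, ∑ j, (∑ k, (α i k * β k j - β i k * α k j)) * X t y i * X t y j) t := by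
    intro t
    have e1 := flow_diag β hβ (fun t => X t y) (hX y) d t
    have e2 := (hasDerivAt_id t).mul (flow_quad β α hβ (fun t => X t y) (hX y) t)
    have e3 := e1.add e2
    refine HasDerivAt.congr_deriv e3 ?_
    simp only [id, one_mul, add_mul, Finset.sum_add_distrib]
    ring
  have := norm_image_sub_le_of_norm_deriv_le_segment_01' (f := fun t => ∑ i, d i * X t y i ^ 2 + t * ∑ i, ∑ j, α i j * X t y i * X t y j)
    (C := 2 * C * Real.exp C * ∑ i, g i * y i ^ 2)
    (fun t _ => (hder t).hasDerivWithinAt) (fun t ht => ?_)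
  · simpa [hX0] using this
  · have hgt : ∑ i, g i * X t y i ^ 2 ≤ Real.exp C * ∑ i, g i * y i ^ 2 := by
      refine (hgr g h3 t ht.1).trans (mul_le_mul_of_nonneg_right (Real.exp_le_exp.2 ?_) hgy)
      nlinarith [ht.1, ht.2]
    have b1 := schur_bd (fun i j => α i j + β i j * (d i - d j)) g C (fun i j => by
      rw [hα i j, hβ i j]; congr 1; ring) h1 (X t y)
    have b2 := schur_bd (fun i j => ∑ k, (α i k * β k j - β i k * α k j)) g C (fun i j => by
      congr 1; refine Finset.sum_congr rfl fun k _ => ?_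
      rw [hα i k, hβ k j, hβ i k, hα k j]; ring) h2 (X t y)
    have hCg := mul_le_mul_of_nonneg_left hgt hC
    rw [Real.norm_eq_abs]
    refine (abs_add_le _ _).trans ?_
    rw [abs_mul, abs_of_nonneg ht.1]
    have := mul_le_mul ht.2.le b2 (abs_nonneg _) zero_le_one
    linarith

open Filter

noncomputable def wt (n : ℕ) : ℝ := (n : ℝ) + 1

lemma wt_pos (n : ℕ) : 0 < wt n := by unfold wt; positivity
lemma one_le_wt (n : ℕ) : 1 ≤ wt n := by unfold wt; linarith [Nat.cast_nonneg (α := ℝ) n]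
lemma wtp_pos (n : ℕ) (p : ℝ) : 0 < wt n ^ p := Real.rpow_pos_of_pos (wt_pos n) p

lemma wt_cmp (m : ℕ) (p : ℝ) : ∃ D : ℝ, 1 ≤ D ∧ ∀ i j : ℕ, i ≤ j + m → j ≤ i + m →
    wt i ^ p ≤ D * wt j ^ p := by
  have hm : (1:ℝ) ≤ (m:ℝ) + 1 := by linarith [Nat.cast_nonneg (α := ℝ) m]
  have key : ∀ i j : ℕ, i ≤ j + m → wt i ≤ ((m:ℝ)+1) * wt j := by
    intro i j h
    have h' : (i:ℝ) ≤ j + m := by exact_mod_cast h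
    unfold wt
    nlinarith [Nat.cast_nonneg (α := ℝ) m, Nat.cast_nonneg (α := ℝ) j,
      mul_nonneg (Nat.cast_nonneg (α := ℝ) m) (Nat.cast_nonneg (α := ℝ) j)]
  refine ⟨((m:ℝ)+1) ^ |p|, Real.one_le_rpow hm (abs_nonneg _), fun i j h1 h2 => ?_⟩
  rcases le_total 0 p with hp | hp
  · rw [abs_of_nonneg hp, ← Real.mul_rpow (by linarith) (wt_pos j).le]
    exact Real.rpow_le_rpow (wt_pos i).le (key i j h1) hp
  · rw [abs_of_nonpos hp]
    have h3 := Real.rpow_le_rpow_of_nonpos (wt_pos j) (key j i h2) hp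
    rw [Real.mul_rpow (by linarith) (wt_pos i).le] at h3
    have h4 : ((m:ℝ)+1) ^ (-p) * ((m:ℝ)+1) ^ p = 1 := by
      rw [← Real.rpow_add (by linarith)]; simp
    have h5 : 0 < ((m:ℝ)+1) ^ (-p) := Real.rpow_pos_of_pos (by linarith) _
    calc wt i ^ p = ((m:ℝ)+1) ^ (-p) * (((m:ℝ)+1) ^ p * wt i ^ p) := by rw [← mul_assoc, h4, one_mul]
      _ ≤ _ := mul_le_mul_of_nonneg_left h3 h5.le

structure KS (m : ℕ) (p C : ℝ) (k : ℕ → ℕ → ℝ) : Prop where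
  band : ∀ i j, (i + m < j ∨ j + m < i) → k i j = 0
  size : ∀ i j, |k i j| ≤ C * wt i ^ p
  diff : ∀ i j, |k (i+1) (j+1) - k i j| ≤ C * wt i ^ (p - 1)

lemma KS.mono {m : ℕ} {p C C' : ℝ} {k : ℕ → ℕ → ℝ} (h : KS m p C k) (hC : C ≤ C') : KS m p C' k :=
  ⟨h.band, fun i j => (h.size i j).trans (mul_le_mul_of_nonneg_right hC (wtp_pos _ _).le),
    fun i j => (h.diff i j).trans (mul_le_mul_of_nonneg_right hC (wtp_pos _ _).le)⟩

lemma KS.add {m : ℕ} {p C C' : ℝ} {k k' : ℕ → ℕ → ℝ} (h : KS m p C k) (h' : KS m p C' k') :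
    KS m p (C + C') (fun i j => k i j + k' i j) := by
  refine ⟨fun i j hij => by simp [h.band i j hij, h'.band i j hij], fun i j => ?_, fun i j => ?_⟩
  · rw [add_mul]; exact (abs_add_le _ _).trans (add_le_add (h.size i j) (h'.size i j))
  · rw [add_mul, add_sub_add_comm]
    exact (abs_add_le _ _).trans (add_le_add (h.diff i j) (h'.diff i j))

lemma shift_bd (m : ℕ) (p : ℝ) : ∃ D : ℝ, 1 ≤ D ∧ ∀ C : ℝ, 0 ≤ C → ∀ k, KS m p C k →
    ∀ i j i' j', i + j' = i' + j → i ≤ i' + m → i' ≤ i + m →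
      |k i j - k i' j'| ≤ C * D * wt i ^ (p - 1) := by
  obtain ⟨D, hD, hc⟩ := wt_cmp m (p-1)
  have h1 : ∀ C : ℝ, 0 ≤ C → ∀ k, KS m p C k → ∀ s i j, s ≤ m →
      |k (i+s) (j+s) - k i j| ≤ (s * (C * D)) * wt i ^ (p - 1) := by
    intro C hC k hk s
    induction s with
    | zero => intro i j _; simp
    | succ s ih =>
      intro i j hs
      have a1 := ih i j (by omega)
      have a2 := hk.diff (i+s) (j+s)
      have a3 := hc (i+s) i (by omega) (by omega)
      have a4 := mul_le_mul_of_nonneg_left a3 hC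
      have a5 := abs_add_le (k (i+s+1) (j+s+1) - k (i+s) (j+s)) (k (i+s) (j+s) - k i j)
      rw [sub_add_sub_cancel] at a5
      push_cast
      rw [← add_assoc, ← add_assoc]
      linarith
  have hm : (0:ℝ) ≤ m := Nat.cast_nonneg m
  refine ⟨(m + 1) * D * D, by nlinarith [mul_le_mul hD hD zero_le_one (by linarith : (0:ℝ) ≤ D), mul_nonneg hm (by positivity : 0 ≤ D * D)], fun C hC k hk i j i' j' he hi hi' => ?_⟩
  have hw := wtp_pos i (p-1)
  rcases le_total i i' with hle | hle
  · obtain ⟨s, rfl⟩ := Nat.exists_eq_add_of_le hle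
    have : j' = j + s := by omega
    subst this
    have hs : s ≤ m := by omega
    have := h1 C hC k hk s i j hs
    rw [abs_sub_comm]
    refine this.trans (mul_le_mul_of_nonneg_right ?_ hw.le)
    have hs' : (s:ℝ) ≤ m := by exact_mod_cast hs
    have : (s:ℝ) ≤ (m+1) * D := by nlinarith
    nlinarith [mul_le_mul_of_nonneg_right this (by positivity : 0 ≤ C * D)]
  · obtain ⟨s, rfl⟩ := Nat.exists_eq_add_of_le hle
    have : j = j' + s := by omega
    subst this
    have hs : s ≤ m := by omega
    have a1 := h1 C hC k hk s i' j' hs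
    have a2 := hc i' (i'+s) (by omega) (by omega)
    refine a1.trans ?_
    have hs' : (s:ℝ) ≤ m + 1 := by have : (s:ℝ) ≤ m := by exact_mod_cast hs
                                   linarith
    have hw' := wtp_pos i' (p-1)
    calc (s * (C * D)) * wt i' ^ (p - 1) ≤ ((m+1) * (C * D)) * wt i' ^ (p-1) := by gcongr
      _ ≤ ((m+1) * (C * D)) * (D * wt (i'+s) ^ (p-1)) := by gcongr
      _ = _ := by ring

lemma band_sum (m i : ℕ) (s : Finset ℕ) (f : ℕ → ℝ) (B : ℝ) (hB : 0 ≤ B)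
    (h1 : ∀ k ∈ s, |f k| ≤ B) (h2 : ∀ k ∈ s, (i + m < k ∨ k + m < i) → f k = 0) :
    ∑ k ∈ s, |f k| ≤ (2 * m + 1) * B := by
  have h3 : ∑ k ∈ s, |f k| = ∑ k ∈ s with (i ≤ k + m ∧ k ≤ i + m), |f k| := by
    symm
    apply Finset.sum_subset (Finset.filter_subset _ _)
    intro k hk hk'
    simp only [Finset.mem_filter, hk, true_and] at hk'
    rw [h2 k hk (by omega), abs_zero]
  rw [h3]
  have h4 : (s.filter (fun k => i ≤ k + m ∧ k ≤ i + m)) ⊆ Finset.Icc (i - m) (i + m) := by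
    intro k hk
    simp only [Finset.mem_filter] at hk
    simp only [Finset.mem_Icc]; omega
  have h5 := Finset.card_le_card h4
  rw [Nat.card_Icc] at h5
  have h6 : ((s.filter (fun k => i ≤ k + m ∧ k ≤ i + m)).card : ℝ) ≤ 2 * m + 1 := by
    have : (s.filter (fun k => i ≤ k + m ∧ k ≤ i + m)).card ≤ 2 * m + 1 := by omega
    exact_mod_cast this
  calc _ ≤ ∑ k ∈ s with (i ≤ k + m ∧ k ≤ i + m), B :=
        Finset.sum_le_sum fun k hk => h1 k (Finset.mem_filter.1 hk).1
    _ = (s.filter (fun k => i ≤ k + m ∧ k ≤ i + m)).card * B := by simp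
    _ ≤ _ := by gcongr

lemma comm_bd (m : ℕ) (p q C : ℝ) (hC : 0 ≤ C) : ∃ C' : ℝ, 0 ≤ C' ∧ ∀ α β, KS m p C α → KS m q C β →
    ∀ M, (∀ i j, (M ≤ i ∨ M ≤ j) → α i j = 0) → (∀ i j, (M ≤ i ∨ M ≤ j) → β i j = 0) →
    ∀ i j, |∑ k ∈ Finset.range M, (α i k * β k j - β i k * α k j)| ≤ C' * wt i ^ (p + q - 1) := by
  obtain ⟨Dp, hDp, hcp⟩ := wt_cmp m p
  obtain ⟨Dq, hDq, hcq⟩ := wt_cmp m q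
  obtain ⟨Dq1, hDq1, hcq1⟩ := wt_cmp m (q-1)
  obtain ⟨Ep, hEp, hsp⟩ := shift_bd m p
  obtain ⟨Eq, hEq, hsq⟩ := shift_bd m q
  have hm : (0:ℝ) ≤ m := Nat.cast_nonneg m
  let C1 := (2 * m + 1) * ((3 * m + 1) * (C * C * (Dp + Dq)))
  let C2 := (2 * m + 1) * (C * (C * Eq * Dq1) + C * (C * Ep))
  have hC1 : 0 ≤ C1 := by positivity
  have hC2 : 0 ≤ C2 := by positivity
  refine ⟨C1 + C2, by positivity, fun α β hα hβ M hαM hβM i j => ?_⟩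
  have hw := wtp_pos i (p+q-1)
  by_cases hbig : i ≤ j + 2 * m ∧ j ≤ i + 2 * m
  swap
  · rw [Finset.sum_eq_zero]
    · simp; positivity
    · intro k _
      by_cases h1 : i + m < k ∨ k + m < i
      · rw [hα.band i k h1, hβ.band i k h1]; ring
      · have h2 : k + m < j ∨ j + m < k := by omega
        rw [hα.band k j h2, hβ.band k j h2]; ring
  by_cases hsmall : i < m ∨ j < m
  · have h1 := band_sum m i (Finset.range M) (fun k => α i k * β k j - β i k * α k j)
      ((C * C * (Dp + Dq)) * wt i ^ (p + q)) (by have := wtp_pos i (p+q); positivity) ?_ ?_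
    · refine (Finset.abs_sum_le_sum_abs _ _).trans (h1.trans ?_)
      have h2 : wt i ≤ 3 * m + 1 := by
        have : i ≤ 3 * m := by omega
        have : (i:ℝ) ≤ 3 * m := by exact_mod_cast this
        unfold wt; linarith
      have h3 : wt i ^ (p+q) = wt i * wt i ^ (p+q-1) := by
        rw [Real.rpow_sub_one (wt_pos i).ne']; field_simp [(wt_pos i).ne']
      rw [h3]
      have h4 : C * C * (Dp + Dq) * (wt i * wt i ^ (p+q-1)) ≤ (3*m+1) * (C * C * (Dp + Dq)) * wt i ^ (p+q-1) := by
        have : 0 ≤ C * C * (Dp + Dq) * wt i ^ (p+q-1) := by positivity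
        nlinarith
      have h5 := mul_le_mul_of_nonneg_left h4 (by positivity : (0:ℝ) ≤ 2 * m + 1)
      have h6 := mul_nonneg hC2 hw.le
      have e : C1 = (2 * m + 1) * ((3 * m + 1) * (C * C * (Dp + Dq))) := rfl
      rw [add_mul, e]
      linarith
    · intro k _
      by_cases h1 : i + m < k ∨ k + m < i
      · simp only [hα.band i k h1, hβ.band i k h1, zero_mul, sub_zero, abs_zero]
        have := wtp_pos i (p+q); positivity
      · have a1 := hα.size i k
        have a2 := (hβ.size k j).trans (mul_le_mul_of_nonneg_left (hcq k i (by omega) (by omega)) hC)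
        have a3 := hβ.size i k
        have a4 := (hα.size k j).trans (mul_le_mul_of_nonneg_left (hcp k i (by omega) (by omega)) hC)
        have w1 := wtp_pos i p
        have w2 := wtp_pos i q
        have b1 := mul_le_mul a1 a2 (abs_nonneg _) (by positivity)
        have b2 := mul_le_mul a3 a4 (abs_nonneg _) (by positivity)
        rw [← abs_mul] at b1 b2
        refine (abs_sub _ _).trans ?_
        rw [Real.rpow_add (wt_pos i)]
        linarith
    · intro k _ h1
      simp only [hα.band i k h1, hβ.band i k h1, zero_mul, sub_zero]
  · have hext : ∀ γ γ' : ℕ → ℕ → ℝ, (∀ i j, (i + m < j ∨ j + m < i) → γ i j = 0) →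
        (∀ i j, (M ≤ i ∨ M ≤ j) → γ i j = 0) →
        ∑ k ∈ Finset.range M, γ i k * γ' k j = ∑ k ∈ Finset.range (i+j+1), γ i k * γ' k j := by
      intro γ γ' hb hM
      refine (Finset.sum_subset (Finset.range_mono (le_max_left M (i+j+1))) ?_).trans
        (Finset.sum_subset (Finset.range_mono (le_max_right M (i+j+1))) ?_).symm
      · intro k _ hk
        rw [Finset.mem_range] at hk
        rw [hM i k (by omega), zero_mul]
      · intro k _ hk
        rw [Finset.mem_range] at hk
        rw [hb i k (by omega), zero_mul]
    rw [Finset.sum_sub_distrib, hext α β hα.band hαM, hext β α hβ.band hβM,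
      ← Finset.sum_range_reflect (fun k => β i k * α k j), ← Finset.sum_sub_distrib]
    have h1 := band_sum m i (Finset.range (i+j+1))
      (fun k => α i k * β k j - β i (i+j+1-1-k) * α (i+j+1-1-k) j)
      ((C * (C * Eq * Dq1) + C * (C * Ep)) * wt i ^ (p + q - 1)) (by positivity) ?_ ?_
    · refine (Finset.abs_sum_le_sum_abs _ _).trans (h1.trans ?_)
      have h6 := mul_nonneg hC1 hw.le
      have e : C2 = (2 * m + 1) * (C * (C * Eq * Dq1) + C * (C * Ep)) := rfl
      rw [add_mul, e]
      linarith
    · intro k hk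
      rw [Finset.mem_range] at hk
      by_cases h1 : i + m < k ∨ k + m < i
      · have h2 : i+j+1-1-k + m < j ∨ j + m < i+j+1-1-k := by omega
        simp only [hα.band i k h1, hα.band _ j h2, zero_mul, mul_zero, sub_zero, abs_zero]
        positivity
      by_cases h3 : k + m < j ∨ j + m < k
      · have h2 : i + m < i+j+1-1-k ∨ i+j+1-1-k + m < i := by omega
        simp only [hβ.band k j h3, hβ.band i _ h2, zero_mul, mul_zero, sub_zero, abs_zero]
        positivity
      have b1 := hsq C hC β hβ k j i (i+j+1-1-k) (by omega) (by omega) (by omega)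
      have b2 := hcq1 k i (by omega) (by omega)
      have b3 : |β k j - β i (i+j+1-1-k)| ≤ C * Eq * Dq1 * wt i ^ (q - 1) := by
        refine b1.trans ?_
        rw [mul_assoc (C * Eq)]
        exact mul_le_mul_of_nonneg_left b2 (by positivity)
      have b4 := hsp C hC α hα i k (i+j+1-1-k) j (by omega) (by omega) (by omega)
      have b5 := hα.size i k
      have b6 := hβ.size i (i+j+1-1-k)
      have w1 := wtp_pos i p
      have w2 := wtp_pos i q
      have w3 := wtp_pos i (p-1)
      have w4 := wtp_pos i (q-1)
      have c1 := mul_le_mul b5 b3 (abs_nonneg _) (by positivity)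
      have c2 := mul_le_mul b6 b4 (abs_nonneg _) (by positivity)
      rw [← abs_mul] at c1 c2
      have e1 : α i k * β k j - β i (i+j+1-1-k) * α (i+j+1-1-k) j
        = α i k * (β k j - β i (i+j+1-1-k)) + β i (i+j+1-1-k) * (α i k - α (i+j+1-1-k) j) := by ring
      rw [e1]
      refine (abs_add_le _ _).trans ((add_le_add c1 c2).trans (le_of_eq ?_))
      have e2 : wt i ^ (p+q-1) = wt i ^ p * wt i ^ (q-1) := by
        rw [← Real.rpow_add (wt_pos i)]; congr 1; ring
      have e3 : wt i ^ q * wt i ^ (p-1) = wt i ^ p * wt i ^ (q-1) := by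
        rw [← Real.rpow_add (wt_pos i), ← Real.rpow_add (wt_pos i)]; congr 1; ring
      rw [e2]
      calc _ = C * (C * Eq * Dq1) * (wt i ^ p * wt i ^ (q-1)) + C * (C * Ep) * (wt i ^ q * wt i ^ (p-1)) := by ring
        _ = _ := by rw [e3]; ring
    · intro k hk h1
      rw [Finset.mem_range] at hk
      have h2 : i+j+1-1-k + m < j ∨ j + m < i+j+1-1-k := by omega
      simp only [hα.band i k h1, hα.band _ j h2, zero_mul, mul_zero, sub_zero]

lemma comm_band (m : ℕ) (α β : ℕ → ℕ → ℝ) (hα : ∀ i j, (i + m < j ∨ j + m < i) → α i j = 0)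
    (hβ : ∀ i j, (i + m < j ∨ j + m < i) → β i j = 0) (s : Finset ℕ) (i j : ℕ)
    (h : i + 2 * m < j ∨ j + 2 * m < i) : ∑ k ∈ s, (α i k * β k j - β i k * α k j) = 0 := by
  refine Finset.sum_eq_zero fun k _ => ?_
  by_cases h1 : i + m < k ∨ k + m < i
  · rw [hα i k h1, hβ i k h1]; ring
  · have h2 : k + m < j ∨ j + m < k := by omega
    rw [hα k j h2, hβ k j h2]; ring

/-- cutoff -/
noncomputable def chi (K n : ℕ) : ℝ := max 0 (min 1 (2 - (n:ℝ) / K))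

lemma chi_nonneg (K n : ℕ) : 0 ≤ chi K n := le_max_left _ _
lemma chi_le_one (K n : ℕ) : chi K n ≤ 1 := max_le zero_le_one (min_le_left _ _)
lemma chi_zero (K n : ℕ) (hK : 1 ≤ K) (h : 2 * K ≤ n) : chi K n = 0 := by
  have hK' : (0:ℝ) < K := by exact_mod_cast hK
  have : (2:ℝ) ≤ n / K := by rw [le_div_iff₀ hK']; exact_mod_cast h
  exact max_eq_left ((min_le_right _ _).trans (by linarith))
lemma one_sub_chi (K n : ℕ) : 1 - chi K n ≤ n / K := by
  have h0 : (0:ℝ) ≤ (n:ℝ) / K := by positivity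
  have : 1 - (n:ℝ)/K ≤ chi K n := by
    refine le_trans ?_ (le_max_right _ _)
    exact le_min (by linarith) (by linarith)
  linarith
lemma chi_diff (K i j : ℕ) (hK : 1 ≤ K) : |chi K (i+1+(j+1)) - chi K (i+j)| ≤ 4 / wt i := by
  have hK' : (0:ℝ) < K := by exact_mod_cast hK
  have hw := wt_pos i
  by_cases h : 2 * K ≤ i + j
  · rw [chi_zero K _ hK h, chi_zero K _ hK (by omega)]; simp; positivity
  · have h1 : |chi K (i+1+(j+1)) - chi K (i+j)| ≤ 2 / K := by
      unfold chi
      rw [max_comm 0, max_comm 0]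
      refine (abs_max_sub_max_le_abs _ _ _).trans ?_
      · refine (abs_min_sub_min_le_max _ _ _ _).trans ?_
        push_cast
        simp only [sub_self, abs_zero]
        refine max_le (by positivity) (le_of_eq ?_)
        have : (2 - ((i:ℝ) + 1 + (j + 1)) / K - (2 - ((i:ℝ) + j) / K)) = - (2 / K) := by field_simp; ring
        rw [this, abs_neg, abs_of_pos (by positivity)]
    refine h1.trans ?_
    rw [div_le_div_iff₀ hK' hw]
    have : wt i ≤ 2 * K := by
      have : i + 1 ≤ 2 * K := by omega
      unfold wt; exact_mod_cast this
    linarith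

lemma KS.chi {m : ℕ} {p C : ℝ} {k : ℕ → ℕ → ℝ} (h : KS m p C k) (K : ℕ) (hK : 1 ≤ K) :
    KS m p (5 * C) (fun i j => chi K (i+j) * k i j) := by
  have hsz : ∀ i j, |_root_.chi K (i+j) * k i j| ≤ |k i j| := by
    intro i j
    rw [abs_mul, abs_of_nonneg (chi_nonneg _ _)]
    exact mul_le_of_le_one_left (abs_nonneg _) (chi_le_one _ _)
  have hC : 0 ≤ C := by
    have := (abs_nonneg _).trans (h.size 0 0)
    exact nonneg_of_mul_nonneg_left this (wtp_pos 0 p)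
  refine ⟨fun i j hij => by simp [h.band i j hij], fun i j => ?_, fun i j => ?_⟩
  · refine (hsz i j).trans ((h.size i j).trans ?_)
    have := wtp_pos i p
    nlinarith [mul_nonneg hC this.le]
  · have e : _root_.chi K (i+1+(j+1)) * k (i+1) (j+1) - _root_.chi K (i+j) * k i j
      = _root_.chi K (i+1+(j+1)) * (k (i+1) (j+1) - k i j) +
        (_root_.chi K (i+1+(j+1)) - _root_.chi K (i+j)) * k i j := by ring
    rw [e]
    refine (abs_add_le _ _).trans ?_
    rw [abs_mul, abs_mul, abs_of_nonneg (chi_nonneg _ _)]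
    have h1 := mul_le_mul (chi_le_one K (i+1+(j+1))) (h.diff i j) (abs_nonneg _) zero_le_one
    have h2 := mul_le_mul (chi_diff K i j hK) (h.size i j) (abs_nonneg _) (by have := wt_pos i; positivity)
    have h3 : 4 / wt i * (C * wt i ^ p) = 4 * (C * wt i ^ (p-1)) := by
      rw [Real.rpow_sub_one (wt_pos i).ne']; ring
    linarith

open Filter Asymptotics

lemma ratio_rpow (R p x y : ℝ) (hR : 1 ≤ R) (hx : 0 < x) (hy : 0 < y) (h1 : x ≤ R * y) (h2 : y ≤ R * x) :
    x ^ p ≤ R ^ |p| * y ^ p := by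
  rcases le_total 0 p with hp | hp
  · rw [abs_of_nonneg hp, ← Real.mul_rpow (by linarith) hy.le]
    exact Real.rpow_le_rpow hx.le h1 hp
  · rw [abs_of_nonpos hp]
    have h3 := Real.rpow_le_rpow_of_nonpos hy h2 hp
    rw [Real.mul_rpow (by linarith) hx.le] at h3
    have h4 : R ^ (-p) * R ^ p = 1 := by
      rw [← Real.rpow_add (by linarith)]; simp
    have h5 : 0 < R ^ (-p) := Real.rpow_pos_of_pos (by linarith) _
    calc x ^ p = R ^ (-p) * (R ^ p * x ^ p) := by rw [← mul_assoc, h4, one_mul]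
      _ ≤ _ := mul_le_mul_of_nonneg_left h3 h5.le

lemma rp_cmp (q : ℝ) (n : ℕ) (hn : 1 ≤ n) (e : ℝ) (h1 : (n:ℝ) ≤ e) (h2 : e ≤ n + 2) :
    e ^ q ≤ 3 ^ |q| * wt n ^ q ∧ wt n ^ q ≤ 3 ^ |q| * e ^ q := by
  have hn' : (1:ℝ) ≤ n := by exact_mod_cast hn
  have a1 : e ≤ 3 * wt n := by unfold wt; linarith
  have a2 : wt n ≤ 3 * e := by unfold wt; linarith
  exact ⟨ratio_rpow 3 q _ _ (by norm_num) (by linarith) (wt_pos n) a1 a2,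
    ratio_rpow 3 q _ _ (by norm_num) (wt_pos n) (by linarith) a2 a1⟩

lemma isBigO_cast_wt (q : ℝ) : (fun n : ℕ => (n:ℝ) ^ q) =O[atTop] fun n => wt n ^ q := by
  refine IsBigO.of_bound (3 ^ |q|) ?_
  filter_upwards [eventually_ge_atTop 1] with n hn
  rw [Real.norm_of_nonneg (by positivity), Real.norm_of_nonneg (wtp_pos _ _).le]
  exact (rp_cmp q n hn n le_rfl (by linarith)).1

lemma isBigO_wt_cast (q : ℝ) : (fun n : ℕ => wt n ^ q) =O[atTop] fun n : ℕ => (n:ℝ) ^ q := by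
  refine IsBigO.of_bound (3 ^ |q|) ?_
  filter_upwards [eventually_ge_atTop 1] with n hn
  rw [Real.norm_of_nonneg (wtp_pos _ _).le, Real.norm_of_nonneg (by positivity)]
  exact (rp_cmp q n hn n le_rfl (by linarith)).2

lemma wt_mono_exp {p q : ℝ} (h : p ≤ q) : (fun n : ℕ => wt n ^ p) =O[atTop] fun n => wt n ^ q := by
  refine IsBigO.of_bound 1 (Eventually.of_forall fun n => ?_)
  rw [Real.norm_of_nonneg (wtp_pos _ _).le, Real.norm_of_nonneg (wtp_pos _ _).le, one_mul]
  exact Real.rpow_le_rpow_of_exponent_le (one_le_wt n) h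

lemma bigO_shift {s : ℕ → ℝ} {p : ℝ} (h : s =O[atTop] fun n => wt n ^ p) :
    (fun n => s (n+1)) =O[atTop] fun n => wt n ^ p := by
  have h1 := h.comp_tendsto (tendsto_add_atTop_nat 1)
  refine IsBigO.trans h1 ?_
  obtain ⟨D, hD, hc⟩ := wt_cmp 1 p
  refine IsBigO.of_bound D (Eventually.of_forall fun n => ?_)
  simp only [Function.comp]
  rw [Real.norm_of_nonneg (wtp_pos _ _).le, Real.norm_of_nonneg (wtp_pos _ _).le]
  exact hc _ _ (by omega) (by omega)

lemma bigO_global {s : ℕ → ℝ} {p : ℝ} (h : s =O[atTop] fun n => wt n ^ p) :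
    ∃ C, 0 ≤ C ∧ ∀ n, |s n| ≤ C * wt n ^ p := by
  obtain ⟨C, hC, hb⟩ := bound_of_isBigO_nat_atTop h
  refine ⟨C, hC.le, fun n => ?_⟩
  have := hb (x := n) (wtp_pos n p).ne'
  rwa [Real.norm_eq_abs, Real.norm_of_nonneg (wtp_pos _ _).le] at this

def Symb (p : ℝ) (s : ℕ → ℝ) : Prop :=
  (s =O[atTop] fun n => wt n ^ p) ∧ ((fun n => s (n+1) - s n) =O[atTop] fun n => wt n ^ (p-1))

lemma Symb.of_small {p : ℝ} {s : ℕ → ℝ} (h : s =O[atTop] fun n => wt n ^ (p-1)) : Symb p s :=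
  ⟨h.trans (wt_mono_exp (by linarith)), (bigO_shift h).sub h⟩

lemma Symb.add {p : ℝ} {s t : ℕ → ℝ} (hs : Symb p s) (ht : Symb p t) : Symb p (fun n => s n + t n) := by
  refine ⟨hs.1.add ht.1, (hs.2.add ht.2).congr_left fun n => by ring⟩

lemma Symb.const_mul {p : ℝ} {s : ℕ → ℝ} (hs : Symb p s) (c : ℝ) : Symb p (fun n => c * s n) := by
  refine ⟨hs.1.const_mul_left c, (hs.2.const_mul_left c).congr_left fun n => by ring⟩

lemma Symb.shift {p : ℝ} {s : ℕ → ℝ} (hs : Symb p s) : Symb p (fun n => s (n+1)) :=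
  ⟨bigO_shift hs.1, bigO_shift hs.2⟩

lemma Symb.mono {p q : ℝ} {s : ℕ → ℝ} (hs : Symb p s) (h : p ≤ q) : Symb q s :=
  ⟨hs.1.trans (wt_mono_exp h), hs.2.trans (wt_mono_exp (by linarith))⟩

lemma Symb.mul {p q : ℝ} {s t : ℕ → ℝ} (hs : Symb p s) (ht : Symb q t) :
    Symb (p+q) (fun n => s n * t n) := by
  refine ⟨(hs.1.mul ht.1).congr_right fun n => (Real.rpow_add (wt_pos n) _ _).symm, ?_⟩
  have h1 := (hs.2.mul (bigO_shift ht.1)).congr_right fun n => (Real.rpow_add (wt_pos n) _ _).symm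
  have h2 := (hs.1.mul ht.2).congr_right fun n => (Real.rpow_add (wt_pos n) _ _).symm
  rw [show p - 1 + q = p + q - 1 by ring] at h1
  rw [show p + (q - 1) = p + q - 1 by ring] at h2
  exact (h1.add h2).congr_left fun n => by ring

lemma Symb.inv {p c : ℝ} {s : ℕ → ℝ} (hs : Symb p s) (hc : 0 < c) (h : ∀ᶠ n in atTop, c * wt n ^ p ≤ s n) :
    Symb (-p) (fun n => (s n)⁻¹) := by
  have h1 : (fun n => (s n)⁻¹) =O[atTop] fun n => wt n ^ (-p) := by
    refine IsBigO.of_bound c⁻¹ ?_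
    filter_upwards [h] with n hn
    have hw := wtp_pos n p
    have hp : 0 < c * wt n ^ p := by positivity
    rw [Real.norm_of_nonneg (inv_nonneg.2 (hp.le.trans hn)), Real.norm_of_nonneg (wtp_pos _ _).le,
      Real.rpow_neg (wt_pos n).le, ← mul_inv]
    exact inv_anti₀ hp hn
  refine ⟨h1, ?_⟩
  have h2 := (hs.2.neg_left.mul ((bigO_shift h1).mul h1)).congr_right (g₂ := fun n => wt n ^ (-p - 1)) fun n => by
    rw [← Real.rpow_add (wt_pos n), ← Real.rpow_add (wt_pos n)]; congr 1; ring
  refine h2.congr' ?_ EventuallyEq.rfl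
  have h' : ∀ᶠ n in atTop, c * wt (n+1) ^ p ≤ s (n+1) := (tendsto_add_atTop_nat 1).eventually h
  filter_upwards [h, h'] with n hn hn'
  have e1 : s n ≠ 0 := (lt_of_lt_of_le (mul_pos hc (wtp_pos n p)) hn).ne'
  have e2 : s (n+1) ≠ 0 := (lt_of_lt_of_le (mul_pos hc (wtp_pos (n+1) p)) hn').ne'
  field_simp
  ring

lemma mvt_pow (p x : ℝ) (hx : 0 < x) : ∃ c, x < c ∧ c < x + 1 ∧ (x+1)^p - x^p = p * c^(p-1) := by
  obtain ⟨c, hc, h⟩ := exists_hasDerivAt_eq_slope (fun x : ℝ => x^p) (fun x => p * x^(p-1))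
    (show x < x+1 by linarith)
    (fun y hy => (Real.continuousAt_rpow_const y p (Or.inl (by linarith [hy.1] : (0:ℝ) < y).ne')).continuousWithinAt)
    (fun y hy => Real.hasDerivAt_rpow_const (Or.inl (by linarith [hy.1] : (0:ℝ) < y).ne'))
  refine ⟨c, hc.1, hc.2, ?_⟩
  rw [h]; simp

lemma mvt_pow2 (p x : ℝ) (hx : 0 < x) : ∃ c, x < c ∧ c < x + 2 ∧
    ((x+1+1)^p - (x+1)^p) - ((x+1)^p - x^p) = p * (p-1) * c^(p-2) := by
  have hd : ∀ y : ℝ, 0 < y → HasDerivAt (fun y : ℝ => (y+1)^p - y^p) (p * (y+1)^(p-1) - p * y^(p-1)) y := by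
    intro y hy
    have h1 := Real.hasDerivAt_rpow_const (x := y) (p := p) (Or.inl hy.ne')
    have h2 := (Real.hasDerivAt_rpow_const (x := y+1) (p := p) (Or.inl (by linarith : (0:ℝ) < y+1).ne')).comp_add_const y 1
    exact h2.sub h1
  obtain ⟨c, hc, h⟩ := exists_hasDerivAt_eq_slope (fun y : ℝ => (y+1)^p - y^p) (fun y => p * (y+1)^(p-1) - p * y^(p-1))
    (show x < x+1 by linarith)
    (fun y hy => (hd y (by linarith [hy.1])).continuousAt.continuousWithinAt)
    (fun y hy => hd y (by linarith [hy.1]))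
  obtain ⟨e, he1, he2, he⟩ := mvt_pow (p-1) c (by linarith [hc.1])
  refine ⟨e, by linarith [hc.1], by linarith [hc.2], ?_⟩
  rw [← mul_sub, he] at h
  have : x + 1 - x = 1 := by ring
  rw [this, div_one] at h
  rw [← h, show p - 1 - 1 = p - 2 by ring]; ring

lemma symb_pow (p : ℝ) : Symb p (fun n : ℕ => (n:ℝ)^p) := by
  refine ⟨isBigO_cast_wt p, IsBigO.of_bound (|p| * 3 ^ |p-1|) ?_⟩
  filter_upwards [eventually_ge_atTop 1] with n hn
  have hn' : (0:ℝ) < n := by exact_mod_cast hn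
  obtain ⟨c, h1, h2, h3⟩ := mvt_pow p n hn'
  have := (rp_cmp (p-1) n hn c h1.le (by linarith)).1
  push_cast
  rw [h3, Real.norm_eq_abs, abs_mul, Real.norm_of_nonneg (wtp_pos _ _).le, mul_assoc,
    abs_of_pos (Real.rpow_pos_of_pos (by linarith) _)]
  exact mul_le_mul_of_nonneg_left this (abs_nonneg _)

lemma symb_wt (p : ℝ) : Symb p (fun n : ℕ => wt n^p) := by
  have := (symb_pow p).shift
  simpa [wt] using this

lemma symb_dpow (p : ℝ) : Symb (p-1) (fun n : ℕ => ((n+1:ℕ):ℝ)^p - (n:ℝ)^p) := by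
  refine ⟨(symb_pow p).2, IsBigO.of_bound (|p * (p-1)| * 3 ^ |p-2|) ?_⟩
  filter_upwards [eventually_ge_atTop 1] with n hn
  have hn' : (0:ℝ) < n := by exact_mod_cast hn
  obtain ⟨c, h1, h2, h3⟩ := mvt_pow2 p n hn'
  have := (rp_cmp (p-2) n hn c h1.le (by linarith)).1
  push_cast
  rw [h3, Real.norm_eq_abs, abs_mul, Real.norm_of_nonneg (wtp_pos _ _).le, mul_assoc,
    abs_of_pos (Real.rpow_pos_of_pos (by linarith : 0 < c) _), show p - 1 - 1 = p - 2 by ring]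
  exact mul_le_mul_of_nonneg_left this (abs_nonneg _)

lemma littleO_wt {p q : ℝ} (h : p < q) : (fun n : ℕ => wt n ^ p) =o[atTop] fun n => wt n ^ q := by
  have hw : Tendsto wt atTop atTop := tendsto_atTop_add_const_right _ _ tendsto_natCast_atTop_atTop
  refine isLittleO_of_tendsto' (Eventually.of_forall fun n h => absurd h (wtp_pos n q).ne') ?_
  have h1 := (tendsto_rpow_neg_atTop (show 0 < q - p by linarith)).comp hw
  refine h1.congr fun n => ?_
  simp only [Function.comp]
  rw [← Real.rpow_sub (wt_pos n)]; congr 1; ring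

section
variable {d : ℕ → ℝ} {c₀ c δ₀ : ℝ}

lemma d_symb 
    (hd : (fun n : ℕ => d n - (c₀ * (n : ℝ) ^ δ₀ + c * (n : ℝ) ^ (δ₀ - 1)))
      =O[atTop] fun n : ℕ => (n : ℝ) ^ (δ₀ - 2)) :
    ∃ r : ℕ → ℝ, (r =O[atTop] fun n => wt n ^ (δ₀ - 2)) ∧
      ∀ n, d (n+1) - d n = c₀ * (((n+1:ℕ):ℝ)^δ₀ - (n:ℝ)^δ₀) + r n := by
  have h1 := hd.trans (isBigO_cast_wt _)
  have h2 := (bigO_shift h1).sub h1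
  have h3 := (symb_pow (δ₀-1)).2.const_mul_left c
  rw [show δ₀ - 1 - 1 = δ₀ - 2 by ring] at h3
  refine ⟨_, h2.add h3, fun n => ?_⟩
  ring

lemma d1_symb
    (hd : (fun n : ℕ => d n - (c₀ * (n : ℝ) ^ δ₀ + c * (n : ℝ) ^ (δ₀ - 1)))
      =O[atTop] fun n : ℕ => (n : ℝ) ^ (δ₀ - 2)) :
    Symb (δ₀-1) (fun n => d (n+1) - d n) := by
  obtain ⟨r, hr, he⟩ := d_symb hd
  simp only [he]
  exact ((symb_dpow δ₀).const_mul c₀).add (Symb.of_small (by rwa [show δ₀ - 1 - 1 = δ₀ - 2 by ring]))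

lemma d1_lower (hδ₀ : 0 < δ₀) (hc₀ : 0 < c₀)
    (hd : (fun n : ℕ => d n - (c₀ * (n : ℝ) ^ δ₀ + c * (n : ℝ) ^ (δ₀ - 1)))
      =O[atTop] fun n : ℕ => (n : ℝ) ^ (δ₀ - 2)) :
    ∃ b : ℝ, 0 < b ∧ ∀ᶠ n in atTop, b * wt n ^ (δ₀-1) ≤ d (n+1) - d n := by
  obtain ⟨r, hr, he⟩ := d_symb hd
  have hr' := hr.trans_isLittleO (littleO_wt (show δ₀ - 2 < δ₀ - 1 by linarith))
  let B := c₀ * (δ₀ * (3 ^ |δ₀-1|)⁻¹)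
  have hB : 0 < B := by positivity
  refine ⟨B/2, by positivity, ?_⟩
  filter_upwards [eventually_ge_atTop 1, hr'.bound (show 0 < B/2 by positivity)] with n hn hrn
  have hn' : (0:ℝ) < n := by exact_mod_cast hn
  obtain ⟨e, h1, h2, h3⟩ := mvt_pow δ₀ n hn'
  have h4 := (rp_cmp (δ₀-1) n hn e h1.le (by linarith)).2
  rw [he]
  push_cast
  rw [h3]
  rw [Real.norm_eq_abs, Real.norm_of_nonneg (wtp_pos _ _).le] at hrn
  have h5 := (abs_le.1 hrn).1
  have h6 : (3 ^ |δ₀-1|)⁻¹ * wt n ^ (δ₀-1) ≤ e ^ (δ₀-1) := by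
    rw [inv_mul_le_iff₀ (by positivity)]; exact h4
  have h7 : B * wt n ^ (δ₀-1) ≤ c₀ * (δ₀ * e ^ (δ₀-1)) := by
    simp only [B]
    have := mul_le_mul_of_nonneg_left h6 (by positivity : 0 ≤ c₀ * δ₀)
    linarith
  linarith

lemma dl_symb (hs : Symb (δ₀-1) (fun n => d (n+1) - d n)) (l : ℕ) (hl : 1 ≤ l) :
    Symb (δ₀-1) (fun n => d (n+l) - d n) := by
  induction l, hl using Nat.le_induction with
  | base => exact hs
  | succ l hl ih =>
    have := ih.shift.add hs
    refine cast ?_ this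
    congr 1
    funext n
    rw [show n + 1 + l = n + (l+1) by ring]; ring

lemma dl_lower {b : ℝ} (hb : 0 < b) (h : ∀ᶠ n in atTop, b * wt n ^ (δ₀-1) ≤ d (n+1) - d n) (l : ℕ) (hl : 1 ≤ l) :
    ∀ᶠ n in atTop, b * wt n ^ (δ₀-1) ≤ d (n+l) - d n := by
  induction l, hl using Nat.le_induction with
  | base => exact h
  | succ l hl ih =>
    filter_upwards [ih, (tendsto_add_atTop_nat l).eventually h] with n h1 h2
    have := mul_pos hb (wtp_pos (n+l) (δ₀-1))
    rw [show n + l + 1 = n + (l+1) by ring] at h2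
    linarith

end

lemma a_symb {f : ℕ → ℝ} {cl δl δ : ℝ} (hδ : δl ≤ δ)
    (ha : (fun n : ℕ => f n - cl * (n : ℝ) ^ δl) =O[atTop] fun n : ℕ => (n : ℝ) ^ (δ - 1)) :
    Symb δ f := by
  have h1 := Symb.of_small (ha.trans (isBigO_cast_wt _))
  have h2 := (((symb_pow δl).const_mul cl).mono hδ).add h1
  refine cast ?_ h2
  congr 1
  funext n; ring

noncomputable def kern (σ : ℝ) (m : ℕ) (s : ℕ → ℕ → ℝ) (i j : ℕ) : ℝ :=
  ∑ l ∈ Finset.Icc 1 m, ((if j = i + l then s l i else 0) + σ * (if i = j + l then s l j else 0))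

lemma KS.sum {m : ℕ} {p : ℝ} (T : Finset ℕ) (C : ℕ → ℝ) (k : ℕ → ℕ → ℕ → ℝ)
    (h : ∀ l ∈ T, KS m p (C l) (k l)) : KS m p (∑ l ∈ T, C l) (fun i j => ∑ l ∈ T, k l i j) := by
  induction T using Finset.induction_on with
  | empty => exact ⟨by simp, by simp, by simp⟩
  | insert l T hl ih =>
    simp only [Finset.sum_insert hl]
    exact (h l (by simp)).add (ih fun l' hl' => h l' (by simp [hl']))

lemma kern_KS (σ : ℝ) (hσ : |σ| ≤ 1) (m : ℕ) (p : ℝ) (s : ℕ → ℕ → ℝ)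
    (hs : ∀ l ∈ Finset.Icc 1 m, Symb p (s l)) : ∃ C, 0 ≤ C ∧ KS m p C (kern σ m s) := by
  have h1 : ∀ l ∈ Finset.Icc 1 m, ∃ C, KS m p C
      (fun i j => (if j = i + l then s l i else 0) + σ * (if i = j + l then s l j else 0)) := by
    intro l hl
    have hl' := Finset.mem_Icc.1 hl
    obtain ⟨C1, hC1, b1⟩ := bigO_global (hs l hl).1
    obtain ⟨C2, hC2, b2⟩ := bigO_global (hs l hl).2
    obtain ⟨D1, hD1, c1⟩ := wt_cmp m p
    obtain ⟨D2, hD2, c2⟩ := wt_cmp m (p-1)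
    have hA : KS m p (C1 + C2) (fun i j => (if j = i + l then s l i else 0)) := by
      refine ⟨fun i j hij => by rw [if_neg]; omega, fun i j => ?_, fun i j => ?_⟩
      · have := wtp_pos i p
        split_ifs
        · exact (b1 i).trans (by gcongr; linarith)
        · simp; positivity
      · have := wtp_pos i (p-1)
        by_cases h : j = i + l
        · rw [if_pos (by omega), if_pos h]
          exact (b2 i).trans (by gcongr; linarith)
        · rw [if_neg (by omega), if_neg h]; simp; positivity
    have hB : KS m p (C1 * D1 + C2 * D2) (fun i j => σ * (if i = j + l then s l j else 0)) := by
      refine ⟨fun i j hij => by rw [if_neg]; simp; omega, fun i j => ?_, fun i j => ?_⟩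
      · have := wtp_pos i p
        rw [abs_mul]
        split_ifs with h
        · have e1 := mul_le_mul hσ (b1 j) (abs_nonneg _) zero_le_one
          have e2 := mul_le_mul_of_nonneg_left (c1 j i (by omega) (by omega)) hC1
          have : 0 ≤ C2 * D2 * wt i ^ p := by positivity
          linarith
        · simp; positivity
      · have := wtp_pos i (p-1)
        rw [← mul_sub, abs_mul]
        by_cases h : i = j + l
        · rw [if_pos (by omega), if_pos h]
          have e1 := mul_le_mul hσ (b2 j) (abs_nonneg _) zero_le_one
          have e2 := mul_le_mul_of_nonneg_left (c2 j i (by omega) (by omega)) hC2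
          have : 0 ≤ C1 * D1 * wt i ^ (p-1) := by positivity
          linarith
        · rw [if_neg (by omega), if_neg h]; simp; positivity
    exact ⟨_, hA.add hB⟩
  choose! C hC using h1
  have := KS.sum (Finset.Icc 1 m) C _ hC
  exact ⟨_, nonneg_of_mul_nonneg_left ((abs_nonneg _).trans (this.size 0 0)) (wtp_pos 0 p), this⟩

lemma kern_symm (m : ℕ) (s : ℕ → ℕ → ℝ) (i j : ℕ) : kern 1 m s i j = kern 1 m s j i := by
  unfold kern
  refine Finset.sum_congr rfl fun l _ => ?_
  ring

lemma kern_anti (m : ℕ) (s : ℕ → ℕ → ℝ) (i j : ℕ) : kern (-1) m s i j = - kern (-1) m s j i := by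
  unfold kern
  rw [← Finset.sum_neg_distrib]
  refine Finset.sum_congr rfl fun l _ => ?_
  ring

open Filter Asymptotics

lemma wt_diff (m : ℕ) (s : ℝ) : ∃ D : ℝ, 0 ≤ D ∧ ∀ i j : ℕ, i ≤ j + m → j ≤ i + m →
    |wt i ^ s - wt j ^ s| ≤ D * wt i ^ (s - 1) := by
  obtain ⟨C1, hC1, b1⟩ := bigO_global (symb_wt s).1
  obtain ⟨C2, hC2, b2⟩ := bigO_global (symb_wt s).2
  obtain ⟨D, hD, h⟩ := shift_bd m s
  have hk : KS m s (C1 + C2) (fun i j => if i = j then wt i ^ s else 0) := by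
    refine ⟨fun i j hij => if_neg (by omega), fun i j => ?_, fun i j => ?_⟩
    · have := wtp_pos i s
      split_ifs
      · exact (b1 i).trans (by nlinarith)
      · simp; positivity
    · have := wtp_pos i (s-1)
      by_cases hij : i = j
      · subst hij
        simp only [if_true]
        exact (b2 i).trans (by nlinarith)
      · simp [hij]; positivity
  refine ⟨(C1 + C2) * D, by positivity, fun i j h1 h2 => ?_⟩
  have := h _ (by positivity) _ hk i i j j (by omega) h1 h2
  simpa using this

lemma fin_real (m : ℕ) (δ κ : ℝ) (hκ : 0 < κ) (d : ℕ → ℝ) (α β : ℕ → ℕ → ℝ) (C : ℝ) (hC : 0 ≤ C)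
    (hα : KS m δ C α) (hβ : KS m (1 - κ) C β) (hs : ∀ i j, α i j = α j i) (ht : ∀ i j, β i j = - β j i)
    (hr : ∀ i j, |α i j + β i j * (d i - d j)| ≤ C * wt i ^ (δ - κ)) :
    ∃ C' : ℝ, 0 ≤ C' ∧ ∀ K : ℕ, 1 ≤ K → ∃ U : (Fin (2*K) → ℝ) ≃ₗ[ℝ] (Fin (2*K) → ℝ), ∀ y,
      (∑ i, U y i ^ 2 = ∑ i, y i ^ 2) ∧
      |∑ i : Fin (2*K), d i * U y i ^ 2 + ∑ i : Fin (2*K), ∑ j : Fin (2*K), α i j * U y i * U y j - ∑ i : Fin (2*K), d i * y i ^ 2| ≤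
        C' * ∑ i : Fin (2*K), wt i ^ (δ - κ) * y i ^ 2 + C' / K * ∑ i : Fin (2*K), wt i ^ (δ + 1) * U y i ^ 2 ∧
      ∑ i : Fin (2*K), wt i ^ (δ + 1) * U y i ^ 2 ≤ C' * ∑ i : Fin (2*K), wt i ^ (δ + 1) * y i ^ 2 := by
  obtain ⟨C1, hC1, hcomm⟩ := comm_bd m δ (1-κ) (5*C) (by positivity)
  obtain ⟨D1, hD1, hg⟩ := wt_diff m (δ-κ)
  obtain ⟨D2, hD2, hh⟩ := wt_diff m (δ+1)
  let E : ℝ := (2*(m:ℝ)+1) * C + (2*((2*m:ℕ):ℝ)+1) * C1 + (2*(m:ℝ)+1) * (5 * C * D1) + (2*(m:ℝ)+1) * (5 * C * D2)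
  have e1 : 0 ≤ (2*(m:ℝ)+1) * C := by positivity
  have e2 : 0 ≤ (2*((2*m:ℕ):ℝ)+1) * C1 := by positivity
  have e3 : 0 ≤ (2*(m:ℝ)+1) * (5 * C * D1) := by positivity
  have e4 : 0 ≤ (2*(m:ℝ)+1) * (5 * C * D2) := by positivity
  have hE : 0 ≤ E := by positivity
  let F : ℝ := (2*m+1)*((m+2)*C)
  have hF : 0 ≤ F := by positivity
  refine ⟨2 * E * Real.exp E + Real.exp E + F, by positivity, fun K hK => ?_⟩
  have hK0 : (0:ℝ) < K := by exact_mod_cast hK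
  have hα' := hα.chi K hK
  have hβ' := hβ.chi K hK
  have hb : ∀ s D : ℝ, 0 ≤ D → (∀ i j : ℕ, i ≤ j + m → j ≤ i + m → |wt i ^ s - wt j ^ s| ≤ D * wt i ^ (s - 1)) →
      ∀ i : Fin (2*K), ∑ j : Fin (2*K), |chi K (i+j) * β i j * (wt i ^ s - wt j ^ s)| ≤ (2*(m:ℝ)+1) * (5 * C * D) * wt i ^ s := by
    intro s D hD hdf i
    rw [← Finset.sum_range (fun j => |chi K (i+j) * β i j * (wt i ^ s - wt j ^ s)|), mul_assoc]
    have hw := wtp_pos i s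
    refine band_sum m i _ _ _ (by positivity) (fun j _ => ?_) (fun j _ hj => by rw [hβ'.band i j hj, zero_mul])
    by_cases hj : (i:ℕ) + m < j ∨ j + m < i
    · rw [hβ'.band i j hj, zero_mul, abs_zero]; positivity
    · push Not at hj
      rw [abs_mul]
      calc _ ≤ (5 * C * wt i ^ (1-κ)) * (D * wt i ^ (s-1)) := by
            have := hβ'.size i j
            exact mul_le_mul this (hdf _ _ hj.2 hj.1) (abs_nonneg _) ((abs_nonneg _).trans this)
        _ = 5 * C * D * (wt i ^ (1-κ) * wt i ^ (s-1)) := by ring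
        _ = 5 * C * D * wt i ^ (s-κ) := by rw [← Real.rpow_add (wt_pos _)]; congr 2; ring
        _ ≤ _ := by
          refine mul_le_mul_of_nonneg_left (Real.rpow_le_rpow_of_exponent_le (one_le_wt _) (by linarith)) (by positivity)
  obtain ⟨U, hU⟩ := flow_main (ι := Fin (2*K)) (fun i j => chi K (i+j) * α i j) (fun i j => chi K (i+j) * β i j)
    (fun i => d i) (fun i => wt i ^ (δ-κ)) (fun i => wt i ^ (δ+1)) E hE
    (fun i j => by rw [ht, add_comm (i:ℕ)]; ring) (fun i j => by rw [hs, add_comm (i:ℕ)])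
    (fun i => (wtp_pos _ _).le)
    (fun i => by
      have hw := wtp_pos i (δ-κ)
      refine le_trans ?_ (mul_le_mul_of_nonneg_right (show (2*(m:ℝ)+1) * C ≤ E by simp only [E]; linarith) hw.le)
      rw [← Finset.sum_range (fun j => |chi K (i+j) * α i j + chi K (i+j) * β i j * (d i - d j)|), mul_assoc]
      refine band_sum m i _ _ _ (by positivity) (fun j _ => ?_) (fun j _ hj => by rw [hβ'.band i j hj, hα'.band i j hj]; ring)
      rw [mul_assoc, ← mul_add, abs_mul, abs_of_nonneg (chi_nonneg _ _)]
      exact (mul_le_of_le_one_left (abs_nonneg _) (chi_le_one _ _)).trans (hr i j))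
    (fun i => by
      have hw := wtp_pos i (δ-κ)
      refine le_trans ?_ (mul_le_mul_of_nonneg_right (show (2*((2*m:ℕ):ℝ)+1) * C1 ≤ E by simp only [E]; linarith) hw.le)
      have e5 : ∀ j : ℕ, (∑ k : Fin (2*K), (chi K (i+k) * α i k * (chi K (k+j) * β k j) - chi K (i+k) * β i k * (chi K (k+j) * α k j)))
          = ∑ k ∈ Finset.range (2*K), (chi K (i+k) * α i k * (chi K (k+j) * β k j) - chi K (i+k) * β i k * (chi K (k+j) * α k j)) :=
        fun j => (Finset.sum_range (fun k : ℕ => (chi K (i+k) * α i k * (chi K (k+j) * β k j) - chi K (i+k) * β i k * (chi K (k+j) * α k j)))).symm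
      simp only [e5]
      rw [← Finset.sum_range (fun j => |∑ k ∈ Finset.range (2*K), (chi K (i+k) * α i k * (chi K (k+j) * β k j) - chi K (i+k) * β i k * (chi K (k+j) * α k j))|), mul_assoc]
      refine band_sum (2*m) i _ _ _ (by positivity) (fun j _ => ?_) (fun j _ hj => ?_)
      · have := hcomm _ _ hα' hβ' (2*K) (fun i j h => by rw [chi_zero K _ hK (by omega), zero_mul])
          (fun i j h => by rw [chi_zero K _ hK (by omega), zero_mul]) i j
        rwa [show δ + (1-κ) - 1 = δ - κ by ring] at this
      · exact comm_band m _ _ hα'.band hβ'.band (Finset.range (2*K)) i j hj)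
    (fun i => (hb (δ-κ) D1 hD1 hg i).trans (mul_le_mul_of_nonneg_right (by simp only [E]; linarith) (wtp_pos _ _).le))
    (fun i => (hb (δ+1) D2 hD2 hh i).trans (mul_le_mul_of_nonneg_right (by simp only [E]; linarith) (wtp_pos _ _).le))
  refine ⟨U, fun y => ?_⟩
  obtain ⟨u1, u2, u3⟩ := hU y
  have hp1 : 0 ≤ ∑ i : Fin (2*K), wt i ^ (δ - κ) * y i ^ 2 :=
    Finset.sum_nonneg fun i _ => mul_nonneg (wtp_pos _ _).le (sq_nonneg _)
  have hp2 : 0 ≤ ∑ i : Fin (2*K), wt i ^ (δ + 1) * y i ^ 2 :=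
    Finset.sum_nonneg fun i _ => mul_nonneg (wtp_pos _ _).le (sq_nonneg _)
  have hp3 : 0 ≤ ∑ i : Fin (2*K), wt i ^ (δ + 1) * U y i ^ 2 :=
    Finset.sum_nonneg fun i _ => mul_nonneg (wtp_pos _ _).le (sq_nonneg _)
  have he := (Real.exp_pos E).le
  have hEE : 0 ≤ 2 * E * Real.exp E := by positivity
  refine ⟨u1, ?_, u3.trans (mul_le_mul_of_nonneg_right (by linarith) hp2)⟩
  have hsch := schur_bd (ι := Fin (2*K)) (fun i j => (1 - chi K (i+j)) * α i j) (fun i => wt i ^ (δ+1)) (F / K)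
    (fun i j => by rw [hs, add_comm (i:ℕ)])
    (fun i => by
      have hw := wtp_pos i (δ+1)
      rw [← Finset.sum_range (fun j => |(1 - chi K (i+j)) * α i j|)]
      have : F / K * wt i ^ (δ+1) = (2*m+1) * (((m+2)*C) / K * wt i ^ (δ+1)) := by simp only [F]; ring
      rw [this]
      refine band_sum m i _ _ _ (by positivity) (fun j _ => ?_) (fun j _ hj => by rw [hα.band i j hj, mul_zero])
      by_cases hj : (i:ℕ) + m < j ∨ j + m < i
      · rw [hα.band i j hj, mul_zero, abs_zero]; positivity
      push Not at hj
      rw [abs_mul, abs_of_nonneg (by linarith [chi_le_one K (i+j)])]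
      calc _ ≤ (((m+2) * wt i) / K) * (C * wt i ^ δ) := by
            refine mul_le_mul ((one_sub_chi K _).trans ?_) (hα.size i j) (abs_nonneg _) (by have := wt_pos i; positivity)
            gcongr
            have : (j:ℝ) ≤ i + m := by exact_mod_cast hj.1
            push_cast
            unfold wt
            nlinarith [Nat.cast_nonneg (α := ℝ) m, Nat.cast_nonneg (α := ℝ) (i:ℕ), mul_nonneg (Nat.cast_nonneg (α := ℝ) m) (Nat.cast_nonneg (α := ℝ) (i:ℕ))]
        _ = _ := by rw [Real.rpow_add_one (wt_pos _).ne']; ring) (U y)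
  have hsplit : ∑ i : Fin (2*K), ∑ j : Fin (2*K), α i j * U y i * U y j = ∑ i : Fin (2*K), ∑ j : Fin (2*K), chi K (i+j) * α i j * U y i * U y j
      + ∑ i : Fin (2*K), ∑ j : Fin (2*K), (1 - chi K (i+j)) * α i j * U y i * U y j := by
    rw [← Finset.sum_add_distrib]
    refine Finset.sum_congr rfl fun i _ => ?_
    rw [← Finset.sum_add_distrib]
    refine Finset.sum_congr rfl fun j _ => ?_
    ring
  rw [hsplit]
  have q1 : 2 * E * Real.exp E * ∑ i : Fin (2*K), wt i ^ (δ - κ) * y i ^ 2 ≤ (2 * E * Real.exp E + Real.exp E + F) * ∑ i : Fin (2*K), wt i ^ (δ - κ) * y i ^ 2 :=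
    mul_le_mul_of_nonneg_right (by linarith) hp1
  have q2 : F / K * ∑ i : Fin (2*K), wt i ^ (δ + 1) * U y i ^ 2 ≤ (2 * E * Real.exp E + Real.exp E + F) / K * ∑ i : Fin (2*K), wt i ^ (δ + 1) * U y i ^ 2 :=
    mul_le_mul_of_nonneg_right (by gcongr; linarith) hp3
  rw [abs_le] at hsch u2 ⊢
  constructor <;> linarith [u2.1, u2.2, hsch.1, hsch.2]

open Filter Asymptotics

/-- complexification of a real linear map -/
noncomputable def cplxMap {ι : Type*} (U : (ι → ℝ) →ₗ[ℝ] (ι → ℝ)) : (ι → ℂ) →ₗ[ℂ] (ι → ℂ) where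
  toFun z i := ⟨U (fun k => (z k).re) i, U (fun k => (z k).im) i⟩
  map_add' x y := by
    funext i
    have h1 : (fun k => ((x + y) k).re) = (fun k => (x k).re) + fun k => (y k).re := by funext k; simp
    have h2 : (fun k => ((x + y) k).im) = (fun k => (x k).im) + fun k => (y k).im := by funext k; simp
    apply Complex.ext
    · change U (fun k => ((x + y) k).re) i = _
      rw [h1, map_add]; rfl
    · change U (fun k => ((x + y) k).im) i = _
      rw [h2, map_add]; rfl
  map_smul' c x := by
    funext i
    have h1 : (fun k => ((c • x) k).re) = c.re • (fun k => (x k).re) - c.im • fun k => (x k).im := by funext k; simp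
    have h2 : (fun k => ((c • x) k).im) = c.re • (fun k => (x k).im) + c.im • fun k => (x k).re := by funext k; simp
    apply Complex.ext
    · change U (fun k => ((c • x) k).re) i = _
      rw [h1, map_sub, map_smul, map_smul]; simp
    · change U (fun k => ((c • x) k).im) i = _
      rw [h2, map_add, map_smul, map_smul]; simp

lemma cplxMap_comp {ι : Type*} (U : (ι → ℝ) ≃ₗ[ℝ] (ι → ℝ)) (z : ι → ℂ) :
    cplxMap (U : (ι → ℝ) →ₗ[ℝ] (ι → ℝ)) (cplxMap (U.symm : (ι → ℝ) →ₗ[ℝ] (ι → ℝ)) z) = z := by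
  funext i
  apply Complex.ext
  · simp [cplxMap]
  · simp [cplxMap]

noncomputable def Qf (d : ℕ → ℝ) (α : ℕ → ℕ → ℝ) (M : ℕ) (x : ℕ → ℂ) : ℝ :=
  ∑ i ∈ Finset.range M, d i * ‖x i‖ ^ 2 +
    ∑ i ∈ Finset.range M, ∑ j ∈ Finset.range M, α i j * ((starRingEnd ℂ (x i)) * x j).re

noncomputable def Qfin (d : ℕ → ℝ) (α : ℕ → ℕ → ℝ) (M : ℕ) (x : Fin M → ℂ) : ℝ :=
  ∑ i : Fin M, d i * ‖x i‖ ^ 2 +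
    ∑ i : Fin M, ∑ j : Fin M, α i j * ((starRingEnd ℂ (x i)) * x j).re

lemma Qf_eq (d : ℕ → ℝ) (α : ℕ → ℕ → ℝ) (M : ℕ) (x : ℕ → ℂ) :
    Qf d α M x = Qfin d α M (fun i => x i) := by
  unfold Qf Qfin
  rw [Finset.sum_range, Finset.sum_range]
  congr 1
  refine Finset.sum_congr rfl fun i _ => ?_
  rw [Finset.sum_range]

lemma cnorm (z : ℂ) : ‖z‖ ^ 2 = z.re ^ 2 + z.im ^ 2 := by
  rw [Complex.sq_norm, Complex.normSq_apply]; ring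

lemma fin_cplx (δ κ : ℝ) (d : ℕ → ℝ) (α : ℕ → ℕ → ℝ) (C : ℝ) (K : ℕ)
    (U : (Fin (2*K) → ℝ) ≃ₗ[ℝ] (Fin (2*K) → ℝ)) (hU : ∀ y,
      (∑ i, U y i ^ 2 = ∑ i, y i ^ 2) ∧
      |∑ i : Fin (2*K), d i * U y i ^ 2 + ∑ i : Fin (2*K), ∑ j : Fin (2*K), α i j * U y i * U y j - ∑ i : Fin (2*K), d i * y i ^ 2| ≤
        C * ∑ i : Fin (2*K), wt i ^ (δ - κ) * y i ^ 2 + C / K * ∑ i : Fin (2*K), wt i ^ (δ + 1) * U y i ^ 2 ∧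
      ∑ i : Fin (2*K), wt i ^ (δ + 1) * U y i ^ 2 ≤ C * ∑ i : Fin (2*K), wt i ^ (δ + 1) * y i ^ 2) (y : Fin (2*K) → ℂ) :
    let x := cplxMap (U : (Fin (2*K) → ℝ) →ₗ[ℝ] (Fin (2*K) → ℝ)) y
    (∑ i, ‖x i‖ ^ 2 = ∑ i, ‖y i‖ ^ 2) ∧
      |Qfin d α (2*K) x - ∑ i : Fin (2*K), d i * ‖y i‖ ^ 2| ≤
        C * ∑ i : Fin (2*K), wt i ^ (δ - κ) * ‖y i‖ ^ 2 + C / K * ∑ i : Fin (2*K), wt i ^ (δ + 1) * ‖x i‖ ^ 2 ∧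
      ∑ i : Fin (2*K), wt i ^ (δ + 1) * ‖x i‖ ^ 2 ≤ C * ∑ i : Fin (2*K), wt i ^ (δ + 1) * ‖y i‖ ^ 2 := by
  intro x
  obtain ⟨a1, a2, a3⟩ := hU (fun k => (y k).re)
  obtain ⟨b1, b2, b3⟩ := hU (fun k => (y k).im)
  have hre : ∀ i, (x i).re = U (fun k => (y k).re) i := fun i => rfl
  have him : ∀ i, (x i).im = U (fun k => (y k).im) i := fun i => rfl
  have hc : ∀ i j, ((starRingEnd ℂ (x i)) * x j).re = (x i).re * (x j).re + (x i).im * (x j).im := by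
    intro i j; simp
  unfold Qfin
  simp only [hc, cnorm, mul_add, Finset.sum_add_distrib, hre, him, ← mul_assoc]
  refine ⟨by linarith, ?_, by linarith⟩
  rw [abs_le] at a2 b2 ⊢
  constructor <;> linarith [a2.1, a2.2, b2.1, b2.2]

lemma up_fin (δ κ : ℝ) (d : ℕ → ℝ) (α : ℕ → ℕ → ℝ) (C : ℝ) (hC : 0 ≤ C) (K : ℕ) 
    (U : (Fin (2*K) → ℝ) ≃ₗ[ℝ] (Fin (2*K) → ℝ)) (hU : ∀ y,
      (∑ i, U y i ^ 2 = ∑ i, y i ^ 2) ∧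
      |∑ i : Fin (2*K), d i * U y i ^ 2 + ∑ i : Fin (2*K), ∑ j : Fin (2*K), α i j * U y i * U y j - ∑ i : Fin (2*K), d i * y i ^ 2| ≤
        C * ∑ i : Fin (2*K), wt i ^ (δ - κ) * y i ^ 2 + C / K * ∑ i : Fin (2*K), wt i ^ (δ + 1) * U y i ^ 2 ∧
      ∑ i : Fin (2*K), wt i ^ (δ + 1) * U y i ^ 2 ≤ C * ∑ i : Fin (2*K), wt i ^ (δ + 1) * y i ^ 2) (n : ℕ) (hn : n < 2 * K)
      (B : ℝ) (hB : ∀ j ≤ n, d j + C * wt j ^ (δ - κ) ≤ B) :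
    ∃ T : (Fin (n+1) → ℂ) →ₗ[ℂ] (ℕ → ℂ), ∀ y, (∀ j, 2 * K ≤ j → T y j = 0) ∧
      (∑ i ∈ Finset.range (2*K), ‖T y i‖ ^ 2 = ∑ i, ‖y i‖ ^ 2) ∧
      Qf d α (2*K) (T y) ≤ (B + C * C / K * ∑ i ∈ Finset.range (n+1), wt i ^ (δ + 1)) * ∑ i, ‖y i‖ ^ 2 := by
  let E : (Fin (n+1) → ℂ) →ₗ[ℂ] (Fin (2*K) → ℂ) :=
    { toFun := fun y i => if h : (i:ℕ) < n+1 then y ⟨i, h⟩ else 0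
      map_add' := fun x y => by funext i; simp only [Pi.add_apply]; split_ifs <;> simp
      map_smul' := fun c y => by funext i; simp only [Pi.smul_apply, RingHom.id_apply]; split_ifs <;> simp }
  let P : (Fin (2*K) → ℂ) →ₗ[ℂ] (ℕ → ℂ) :=
    { toFun := fun y i => if h : i < 2*K then y ⟨i, h⟩ else 0
      map_add' := fun x y => by funext i; simp only [Pi.add_apply]; split_ifs <;> simp
      map_smul' := fun c y => by funext i; simp only [Pi.smul_apply, RingHom.id_apply]; split_ifs <;> simp }
  have hEs : ∀ (w : ℕ → ℝ) (y : Fin (n+1) → ℂ), ∑ i : Fin (2*K), w i * ‖E y i‖ ^ 2 = ∑ i : Fin (n+1), w i * ‖y i‖ ^ 2 := by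
    intro w y
    let G : ℕ → ℝ := fun i => if h : i < n+1 then w i * ‖y ⟨i, h⟩‖ ^ 2 else 0
    have h1 : ∀ i : Fin (2*K), w i * ‖E y i‖ ^ 2 = G i := by
      intro i; simp only [E, G, LinearMap.coe_mk, AddHom.coe_mk]; split_ifs <;> simp
    have h2 : ∀ i : Fin (n+1), w i * ‖y i‖ ^ 2 = G i := by
      intro i; simp only [G]; rw [dif_pos i.2]
    simp only [h1, h2]
    rw [← Finset.sum_range, ← Finset.sum_range]
    symm
    apply Finset.sum_subset
    · intro i; simp; omega
    · intro i _ hi; simp only [Finset.mem_range] at hi; exact dif_neg hi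
  refine ⟨P ∘ₗ (cplxMap (U : (Fin (2*K) → ℝ) →ₗ[ℝ] (Fin (2*K) → ℝ))) ∘ₗ E, fun y => ?_⟩
  obtain ⟨u1, u2, u3⟩ := fin_cplx δ κ d α C K U hU (E y)
  set x := cplxMap (U : (Fin (2*K) → ℝ) →ₗ[ℝ] (Fin (2*K) → ℝ)) (E y) with hx
  have hT : (P ∘ₗ (cplxMap (U : (Fin (2*K) → ℝ) →ₗ[ℝ] (Fin (2*K) → ℝ))) ∘ₗ E) y = P x := rfl
  have hPx : ∀ i : Fin (2*K), P x i = x i := by intro i; simp [P, i.2]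
  rw [hT]
  have hE1 := hEs (fun _ => 1) y
  simp only [one_mul] at hE1
  refine ⟨fun j hj => by simp [P, hj], ?_, ?_⟩
  · rw [Finset.sum_range]
    simp only [hPx]
    rw [u1, hE1]
  · rw [Qf_eq]
    simp only [hPx]
    rw [hEs d y, hEs (fun i => wt i ^ (δ-κ)) y] at u2
    rw [hEs (fun i => wt i ^ (δ+1)) y] at u3
    have h3 : ∑ i : Fin (n+1), wt i ^ (δ+1) * ‖y i‖ ^ 2 ≤ (∑ i ∈ Finset.range (n+1), wt i ^ (δ + 1)) * ∑ i, ‖y i‖ ^ 2 := by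
      rw [Finset.sum_range, Finset.sum_mul]
      refine Finset.sum_le_sum fun i _ => mul_le_mul_of_nonneg_left ?_ (wtp_pos _ _).le
      exact Finset.single_le_sum (f := fun i => ‖y i‖ ^ 2) (fun i _ => by positivity) (Finset.mem_univ i)
    have h4 : ∑ i : Fin (n+1), d i * ‖y i‖ ^ 2 + C * ∑ i : Fin (n+1), wt i ^ (δ-κ) * ‖y i‖ ^ 2 ≤ B * ∑ i, ‖y i‖ ^ 2 := by
      rw [Finset.mul_sum, Finset.mul_sum, ← Finset.sum_add_distrib]
      refine Finset.sum_le_sum fun i _ => ?_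
      rw [← mul_assoc, ← add_mul]
      exact mul_le_mul_of_nonneg_right (hB i (by omega)) (by positivity)
    have h5 : C / K * ∑ i : Fin (2*K), wt i ^ (δ + 1) * ‖x i‖ ^ 2 ≤ C / K * (C * ((∑ i ∈ Finset.range (n+1), wt i ^ (δ + 1)) * ∑ i, ‖y i‖ ^ 2)) := by
      refine mul_le_mul_of_nonneg_left (u3.trans ?_) (by positivity)
      exact mul_le_mul_of_nonneg_left h3 hC
    have h6 := (abs_le.1 u2).2
    have h7 : C / K * (C * ((∑ i ∈ Finset.range (n+1), wt i ^ (δ + 1)) * ∑ i, ‖y i‖ ^ 2)) = (C * C / K * ∑ i ∈ Finset.range (n+1), wt i ^ (δ + 1)) * ∑ i, ‖y i‖ ^ 2 := by ring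
    rw [add_mul]
    linarith

lemma low_fin (δ κ : ℝ) (d : ℕ → ℝ) (α : ℕ → ℕ → ℝ) (C : ℝ) (K : ℕ) 
    (U : (Fin (2*K) → ℝ) ≃ₗ[ℝ] (Fin (2*K) → ℝ)) (hU : ∀ y,
      (∑ i, U y i ^ 2 = ∑ i, y i ^ 2) ∧
      |∑ i : Fin (2*K), d i * U y i ^ 2 + ∑ i : Fin (2*K), ∑ j : Fin (2*K), α i j * U y i * U y j - ∑ i : Fin (2*K), d i * y i ^ 2| ≤
        C * ∑ i : Fin (2*K), wt i ^ (δ - κ) * y i ^ 2 + C / K * ∑ i : Fin (2*K), wt i ^ (δ + 1) * U y i ^ 2 ∧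
      ∑ i : Fin (2*K), wt i ^ (δ + 1) * U y i ^ 2 ≤ C * ∑ i : Fin (2*K), wt i ^ (δ + 1) * y i ^ 2) (n : ℕ) (hn : n < 2 * K)
      (B : ℝ) (hB : ∀ j, n ≤ j → B ≤ d j - C * wt j ^ (δ - κ)) :
    ∃ S : (ℕ → ℂ) →ₗ[ℂ] (Fin n → ℂ), ∀ x, S x = 0 →
      B * ∑ i ∈ Finset.range (2*K), ‖x i‖ ^ 2 - C / K * ∑ i ∈ Finset.range (2*K), wt i ^ (δ+1) * ‖x i‖ ^ 2 ≤ Qf d α (2*K) x := by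
  let V := cplxMap (U.symm : (Fin (2*K) → ℝ) →ₗ[ℝ] (Fin (2*K) → ℝ))
  let R : (ℕ → ℂ) →ₗ[ℂ] (Fin (2*K) → ℂ) := LinearMap.funLeft ℂ ℂ (fun i : Fin (2*K) => (i:ℕ))
  let P : (Fin (2*K) → ℂ) →ₗ[ℂ] (Fin n → ℂ) := LinearMap.funLeft ℂ ℂ (fun i : Fin n => (⟨i, by omega⟩ : Fin (2*K)))
  refine ⟨P ∘ₗ V ∘ₗ R, fun x hx => ?_⟩
  obtain ⟨u1, u2, u3⟩ := fin_cplx δ κ d α C K U hU (V (R x))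
  have hz : ∀ i : Fin (2*K), (i:ℕ) < n → V (R x) i = 0 := by
    intro i hi
    exact congrFun hx ⟨i, hi⟩
  simp only [V] at u1 u2 u3
  rw [cplxMap_comp] at u1 u2 u3
  change ∀ i : Fin (2*K), (i:ℕ) < n → cplxMap (U.symm : (Fin (2*K) → ℝ) →ₗ[ℝ] (Fin (2*K) → ℝ)) (R x) i = 0 at hz
  set y := cplxMap (U.symm : (Fin (2*K) → ℝ) →ₗ[ℝ] (Fin (2*K) → ℝ)) (R x)
  rw [Qf_eq, Finset.sum_range, Finset.sum_range]
  have hR : R x = fun i : Fin (2*K) => x i := rfl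
  rw [hR] at u1 u2
  rw [u1]
  have h4 : B * ∑ i, ‖y i‖ ^ 2 ≤ ∑ i : Fin (2*K), d i * ‖y i‖ ^ 2 - C * ∑ i : Fin (2*K), wt i ^ (δ-κ) * ‖y i‖ ^ 2 := by
    rw [Finset.mul_sum, Finset.mul_sum, ← Finset.sum_sub_distrib]
    refine Finset.sum_le_sum fun i _ => ?_
    rw [← mul_assoc, ← sub_mul]
    by_cases hi : (i:ℕ) < n
    · rw [hz i hi]; simp
    · exact mul_le_mul_of_nonneg_right (hB i (by omega)) (by positivity)
  have h6 := (abs_le.1 u2).1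
  linarith

open Filter Asymptotics

lemma offDiag_kern (m : ℕ) (a : ℕ → ℕ → ℝ) (x : ℕ → ℂ) (j M : ℕ)
    (h : ∀ i, i ≤ j + m → M ≤ i → x i = 0) :
    offDiagOp m a x j = ∑ i ∈ Finset.range M, (kern 1 m a j i : ℂ) * x i := by
  unfold offDiagOp kern
  push_cast
  simp only [Finset.sum_mul]
  rw [Finset.sum_comm]
  refine Finset.sum_congr rfl fun l hl => ?_
  have hl' := Finset.mem_Icc.1 hl
  simp only [one_mul, add_mul, Finset.sum_add_distrib, apply_ite Complex.ofReal, Complex.ofReal_zero, ite_mul, zero_mul]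
  congr 1
  · rw [Finset.sum_ite_eq' (Finset.range M) (j+l) (fun i => (a l j : ℂ) * x i)]
    split_ifs with h1
    · rfl
    · rw [h (j+l) (by omega) (by simpa using h1), mul_zero]
  · by_cases hlj : l ≤ j
    · rw [if_pos hlj]
      have : ∀ i, (if j = i + l then (a l i : ℂ) * x i else 0) = if i = j - l then (a l i : ℂ) * x i else 0 := by
        intro i; congr 1; simp only [eq_iff_iff]; omega
      simp only [this]
      rw [Finset.sum_ite_eq' (Finset.range M) (j-l) (fun i => (a l i : ℂ) * x i)]
      split_ifs with h1
      · rfl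
      · rw [h (j-l) (by omega) (by simpa using h1), mul_zero]
    · rw [if_neg hlj]
      symm
      refine Finset.sum_eq_zero fun i _ => if_neg (by omega)

lemma kern_band (σ : ℝ) (m : ℕ) (s : ℕ → ℕ → ℝ) (i j : ℕ) (h : i + m < j ∨ j + m < i) : kern σ m s i j = 0 := by
  unfold kern
  refine Finset.sum_eq_zero fun l hl => ?_
  have hl' := Finset.mem_Icc.1 hl
  rw [if_neg (by omega), if_neg (by omega)]; simp

lemma inner_fin (w x : lp (fun _ : ℕ => ℂ) 2) (M : ℕ) (hx : ∀ j, M ≤ j → x j = 0) :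
    inner ℂ w x = ∑ j ∈ Finset.range M, (starRingEnd ℂ (w j)) * x j := by
  rw [lp.inner_eq_tsum, tsum_eq_sum (s := Finset.range M)]
  · refine Finset.sum_congr rfl fun j _ => ?_
    rw [RCLike.inner_apply, mul_comm]
  · intro j hj
    rw [hx j (by simpa using hj)]; simp

lemma Qf_complex (m : ℕ) (d : ℕ → ℝ) (a : ℕ → ℕ → ℝ) (M : ℕ) (x : ℕ → ℂ) :
    (∑ j ∈ Finset.range M, (starRingEnd ℂ (x j)) * ((d j : ℂ) * x j + ∑ i ∈ Finset.range M, (kern 1 m a j i : ℂ) * x i)).re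
      = Qf d (kern 1 m a) M x := by
  unfold Qf
  rw [Complex.re_sum, ← Finset.sum_add_distrib]
  refine Finset.sum_congr rfl fun j _ => ?_
  rw [mul_add, Complex.add_re]
  congr 1
  · rw [cnorm]; simp; ring
  · rw [Finset.mul_sum, Complex.re_sum]
    refine Finset.sum_congr rfl fun i _ => ?_
    rw [show (starRingEnd ℂ (x j)) * ((kern 1 m a j i : ℂ) * x i) = (kern 1 m a j i : ℂ) * ((starRingEnd ℂ (x j)) * x i) by ring, Complex.re_ofReal_mul]

lemma fin_mem (x : ℕ → ℂ) (M : ℕ) (hx : ∀ j, M ≤ j → x j = 0) : Memℓp x 2 := by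
  refine (memℓp_zero ?_).of_exponent_ge (zero_le)
  refine (Finset.range M).finite_toSet.subset fun i hi => ?_
  by_contra h
  exact hi (hx i (by simpa using h))

lemma upper_core (m : ℕ) (d : ℕ → ℝ) (a : ℕ → ℕ → ℝ)
    (lam : ℕ → ℝ) (v : ℕ → lp (fun _ : ℕ => ℂ) 2)
    (heig : IsEigenSystem m d a lam v) (n M : ℕ) (T : (Fin (n+1) → ℂ) →ₗ[ℂ] (ℕ → ℂ))
    (hT : ∀ y j, M ≤ j → T y j = 0) :
    ∃ y, y ≠ 0 ∧ lam n * ∑ i ∈ Finset.range M, ‖T y i‖ ^ 2 ≤ Qf d (kern 1 m a) M (T y) := by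
  obtain ⟨ho, hsp, hmono, -, hev⟩ := heig
  let b := HilbertBasis.mk ho hsp.ge
  have hb : ∀ k, b k = v k := fun k => congrFun (HilbertBasis.coe_mk ho hsp.ge) k
  let L : (Fin (n+1) → ℂ) →ₗ[ℂ] (Fin n → ℂ) :=
    LinearMap.pi fun k => ∑ j ∈ Finset.range M, (starRingEnd ℂ (v k j)) • (LinearMap.proj j ∘ₗ T)
  have hL : LinearMap.ker L ≠ ⊥ := L.ker_ne_bot_of_finrank_lt (by simp)
  obtain ⟨y, hy, hy0⟩ := (Submodule.ne_bot_iff _).1 hL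
  refine ⟨y, hy0, ?_⟩
  have hx := hT y
  have hLy : ∀ k : ℕ, k < n → ∑ j ∈ Finset.range M, (starRingEnd ℂ (v k j)) * T y j = 0 := by
    intro k hk
    have := congrFun (LinearMap.mem_ker.1 hy) ⟨k, hk⟩
    simpa [L] using this
  generalize T y = x at *
  let f : lp (fun _ : ℕ => ℂ) 2 := ⟨x, fin_mem x M hx⟩
  have hg0 : ∀ j, M + m ≤ j → bandOp m d a x j = 0 := by
    intro j hj
    unfold bandOp
    rw [hx j (by omega), offDiag_kern m a x j M (fun i _ hi => hx i hi)]
    rw [Finset.sum_eq_zero, mul_zero, add_zero]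
    intro i hi
    rw [Finset.mem_range] at hi
    rw [kern_band 1 m a j i (by omega)]; simp
  let g : lp (fun _ : ℕ => ℂ) 2 := ⟨bandOp m d a x, fin_mem _ (M+m) hg0⟩
  have hif : ∀ k, inner ℂ (v k) f = ∑ j ∈ Finset.range M, (starRingEnd ℂ (v k j)) * x j :=
    fun k => inner_fin _ _ M hx
  have hig : ∀ k, inner ℂ (v k) g = (lam k : ℂ) * inner ℂ (v k) f := by
    intro k
    rw [hif, inner_fin _ _ (M+m) hg0]
    change ∑ j ∈ Finset.range (M+m), (starRingEnd ℂ (v k j)) * bandOp m d a x j = _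
    have e1 : ∀ j, bandOp m d a x j = (d j : ℂ) * x j + ∑ i ∈ Finset.range M, (kern 1 m a j i : ℂ) * x i := by
      intro j; unfold bandOp; rw [offDiag_kern m a x j M (fun i _ hi => hx i hi)]
    have e2 : ∀ i ∈ Finset.range M, (lam k : ℂ) * v k i = (d i : ℂ) * v k i + ∑ j ∈ Finset.range (M+m), (kern 1 m a i j : ℂ) * v k j := by
      intro i hi
      rw [Finset.mem_range] at hi
      rw [← hev]; unfold bandOp; rw [offDiag_kern m a _ i (M+m) (fun i' h1 h2 => by omega)]
    simp only [e1, mul_add, Finset.sum_add_distrib]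
    have e3 : ∑ j ∈ Finset.range (M+m), (starRingEnd ℂ (v k j)) * ((d j : ℂ) * x j) = ∑ j ∈ Finset.range M, (starRingEnd ℂ (v k j)) * ((d j : ℂ) * x j) := by
      symm
      apply Finset.sum_subset
      · intro i; simp; omega
      · intro i _ hi; rw [hx i (by simpa using hi)]; simp
    rw [e3]
    simp only [Finset.mul_sum]
    rw [Finset.sum_comm, ← Finset.sum_add_distrib]
    refine Finset.sum_congr rfl fun i hi => ?_
    have e4 := congrArg (starRingEnd ℂ) (e2 i hi)
    simp only [map_add, map_mul, map_sum, Complex.conj_ofReal] at e4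
    rw [← mul_assoc (lam k : ℂ), e4, add_mul, Finset.sum_mul]
    congr 1
    · ring
    · refine Finset.sum_congr rfl fun j _ => ?_
      rw [kern_symm m a i j]; ring
  have hs1 := b.hasSum_inner_mul_inner f f
  have hs2 := b.hasSum_inner_mul_inner f g
  simp only [hb, hig] at hs1 hs2
  have hs1' := Complex.hasSum_re hs1
  have hs2' := Complex.hasSum_re hs2
  have hn1 : (inner ℂ f f).re = ∑ i ∈ Finset.range M, ‖x i‖ ^ 2 := by
    rw [inner_fin f f M hx, Complex.re_sum]
    refine Finset.sum_congr rfl fun i _ => ?_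
    change (starRingEnd ℂ (x i) * x i).re = _
    rw [cnorm]; simp; ring
  have hn2 : (inner ℂ f g).re = Qf d (kern 1 m a) M x := by
    rw [← Qf_complex, inner_fin f g (M+m) hg0]
    change (∑ j ∈ Finset.range (M+m), (starRingEnd ℂ (x j)) * bandOp m d a x j).re = _
    congr 1
    symm
    rw [← Finset.sum_subset (Finset.range_subset_range.2 (show M ≤ M + m by omega))]
    · refine Finset.sum_congr rfl fun j _ => ?_
      unfold bandOp; rw [offDiag_kern m a x j M (fun i _ hi => hx i hi)]
    · intro i _ hi; rw [hx i (by simpa using hi)]; simp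
  rw [hn1] at hs1'
  rw [hn2] at hs2'
  refine hasSum_le (fun k => ?_) (hs1'.mul_left (lam n)) hs2'
  have e5 : inner ℂ f (v k) * inner ℂ (v k) f = ((‖(inner ℂ (v k) f : ℂ)‖^2 : ℝ) : ℂ) := by
    rw [← inner_conj_symm f (v k), mul_comm, Complex.mul_conj, Complex.normSq_eq_norm_sq]
  have e6 : inner ℂ f (v k) * ((lam k : ℂ) * inner ℂ (v k) f) = ((lam k * ‖(inner ℂ (v k) f : ℂ)‖^2 : ℝ) : ℂ) := by
    rw [mul_left_comm, e5]; push_cast; ring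
  rw [e5, e6, Complex.ofReal_re, Complex.ofReal_re]
  by_cases hk : k < n
  · rw [hif, hLy k hk]; simp
  · exact mul_le_mul_of_nonneg_right (hmono (by omega)) (by positivity)

open Filter Asymptotics

lemma decay_half (m : ℕ) (d : ℕ → ℝ) (a : ℕ → ℕ → ℝ) (hsa : StandingAssumptions m d a) (lam : ℝ) (w : ℕ → ℂ)
    (hw : ∀ j, ‖w j‖ ≤ 1) (he : ∀ j, bandOp m d a w j = (lam : ℂ) * w j) :
    ∃ J : ℕ, ∀ r j : ℕ, J + r * (m+1) ≤ j → ‖w j‖ ≤ (1/2) ^ r := by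
  obtain ⟨h1, h2⟩ := hsa
  have hη : (0:ℝ) < 1 / (4 * ((m:ℝ)+1)) := by positivity
  have h3 : ∀ᶠ j in atTop, ∀ l ∈ Finset.Icc 1 m,
      ((if l ≤ j then |a l (j - l)| else 0) + |a l j|) / d j < 1 / (4 * ((m:ℝ)+1)) := by
    rw [Filter.eventually_all_finset]
    intro l hl
    exact (h1 l hl).eventually_lt_const hη
  obtain ⟨J, hJ⟩ := eventually_atTop.1 (h3.and (h2.eventually_ge_atTop (2 * |lam| + 1)))
  refine ⟨J, fun r => ?_⟩
  induction r with
  | zero => intro j _; simpa using hw j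
  | succ r ih =>
    intro j hj
    have hj' : J + r * (m+1) + (m + 1) ≤ j := by rw [add_mul] at hj; omega
    obtain ⟨k1, k2⟩ := hJ j (by nlinarith)
    have hd : 0 < d j := by linarith [abs_nonneg lam]
    have e1 : ((lam - d j : ℝ) : ℂ) * w j = offDiagOp m a w j := by
      have := he j
      unfold bandOp at this
      push_cast
      rw [sub_mul, ← this]; ring
    have e2 : ‖offDiagOp m a w j‖ ≤ ∑ l ∈ Finset.Icc 1 m, (d j * (1 / (4 * ((m:ℝ)+1)))) * (1/2)^r := by
      unfold offDiagOp
      refine (norm_sum_le _ _).trans (Finset.sum_le_sum fun l hl => ?_)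
      have hl' := Finset.mem_Icc.1 hl
      have hk := k1 l hl
      rw [div_lt_iff₀ hd] at hk
      have g1 : ‖w (j+l)‖ ≤ (1/2)^r := ih _ (by omega)
      have g2 : ‖w (j-l)‖ ≤ (1/2)^r := ih _ (by omega)
      have hlj : l ≤ j := by omega
      rw [if_pos hlj] at hk ⊢
      refine (norm_add_le _ _).trans ?_
      rw [norm_mul, norm_mul, Complex.norm_real, Complex.norm_real, Real.norm_eq_abs, Real.norm_eq_abs]
      calc _ ≤ |a l j| * (1/2)^r + |a l (j-l)| * (1/2)^r := by gcongr
        _ = (|a l (j-l)| + |a l j|) * (1/2)^r := by ring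
        _ ≤ _ := by
          refine mul_le_mul_of_nonneg_right ?_ (by positivity)
          linarith
    rw [← e1, norm_mul, Complex.norm_real, Real.norm_eq_abs, Finset.sum_const, Nat.card_Icc, nsmul_eq_mul] at e2
    have e3 : d j / 2 ≤ |lam - d j| := by
      rw [abs_sub_comm]
      have := le_abs_self (d j - lam)
      have := le_abs_self lam
      linarith [abs_nonneg lam]
    have e4 : d j / 2 * ‖w j‖ ≤ |lam - d j| * ‖w j‖ := mul_le_mul_of_nonneg_right e3 (norm_nonneg _)
    have e5 : ((m + 1 - 1 : ℕ) : ℝ) * (d j * (1 / (4 * ((m:ℝ)+1))) * (1/2)^r) ≤ d j / 4 * (1/2)^r := by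
      have : ((m + 1 - 1 : ℕ) : ℝ) = m := by simp
      rw [this]
      have : (m:ℝ) * (1 / (4 * ((m:ℝ)+1))) ≤ 1 / 4 := by
        rw [mul_one_div, div_le_div_iff₀ (by positivity) (by norm_num)]; linarith
      calc _ = ((m:ℝ) * (1 / (4 * ((m:ℝ)+1)))) * (d j * (1/2)^r) := by ring
        _ ≤ 1/4 * (d j * (1/2)^r) := mul_le_mul_of_nonneg_right this (by positivity)
        _ = _ := by ring
    have e6 : d j / 2 * ‖w j‖ ≤ d j / 2 * (1/2)^(r+1) := by
      rw [pow_succ]; linarith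
    exact le_of_mul_le_mul_left e6 (by positivity)

lemma decay_sum (m : ℕ) (d : ℕ → ℝ) (a : ℕ → ℕ → ℝ) (hsa : StandingAssumptions m d a) (lam : ℝ) (w : ℕ → ℂ)
    (hw : ∀ j, ‖w j‖ ≤ 1) (he : ∀ j, bandOp m d a w j = (lam : ℂ) * w j) (p : ℝ) :
    Summable fun j => wt j ^ p * ‖w j‖ := by
  obtain ⟨J, hJ⟩ := decay_half m d a hsa lam w hw he
  let θ : ℝ := (1/2:ℝ) ^ (1/((m+1:ℕ):ℝ))
  have hθ0 : 0 < θ := by positivity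
  have hθ1 : θ < 1 := Real.rpow_lt_one (by norm_num) (by norm_num) (by positivity)
  have hθm : θ ^ (m+1) = 1/2 := by
    simp only [θ]
    rw [← Real.rpow_natCast, ← Real.rpow_mul (by norm_num), one_div_mul_cancel (by positivity), Real.rpow_one]
  have hb : ∀ j, ‖w j‖ ≤ (θ ^ (J+m))⁻¹ * θ ^ j := by
    intro j
    rw [inv_mul_eq_div, le_div_iff₀ (by positivity)]
    by_cases hj : J ≤ j
    · have h1 := hJ ((j-J)/(m+1)) j (by have := Nat.div_mul_le_self (j-J) (m+1); omega)
      rw [← hθm, ← pow_mul] at h1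
      calc _ ≤ θ ^ ((m+1) * ((j-J)/(m+1))) * θ ^ (J+m) := mul_le_mul_of_nonneg_right h1 (by positivity)
        _ = θ ^ ((m+1) * ((j-J)/(m+1)) + (J+m)) := (pow_add _ _ _).symm
        _ ≤ _ := by
          refine pow_le_pow_of_le_one hθ0.le hθ1.le ?_
          have h2 := Nat.div_add_mod (j-J) (m+1)
          have h3 := Nat.mod_lt (j-J) (show 0 < m+1 by omega)
          omega
    · calc _ ≤ 1 * θ ^ (J+m) := mul_le_mul_of_nonneg_right (hw j) (by positivity)
        _ = θ ^ (J+m) := one_mul _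
        _ ≤ _ := pow_le_pow_of_le_one hθ0.le hθ1.le (by omega)
  let N := ⌈p⌉₊
  have hs := summable_pow_mul_geometric_of_norm_lt_one N (show ‖θ‖ < 1 by rwa [Real.norm_of_nonneg hθ0.le])
  have hs2 := ((summable_nat_add_iff 1).2 hs).mul_left ((θ ^ (J+m))⁻¹ * θ⁻¹)
  refine Summable.of_nonneg_of_le (fun j => mul_nonneg (wtp_pos _ _).le (norm_nonneg _)) (fun j => ?_) hs2
  have h1 : wt j ^ p ≤ ((j+1:ℕ):ℝ) ^ N := by
    have : wt j = ((j+1:ℕ):ℝ) := by unfold wt; push_cast; rfl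
    rw [← Real.rpow_natCast, ← this]
    exact Real.rpow_le_rpow_of_exponent_le (one_le_wt j) (Nat.le_ceil p)
  calc _ ≤ ((j+1:ℕ):ℝ) ^ N * ((θ ^ (J+m))⁻¹ * θ ^ j) := mul_le_mul h1 (hb j) (norm_nonneg _) (by positivity)
    _ = _ := by rw [pow_succ θ j]; field_simp

lemma tail_bd {f : ℕ → ℂ} {A : ℂ} {w : ℕ → ℝ} {B : ℝ} (hf : HasSum f A) (hw : Summable w)
    (h : ∀ j, ‖f j‖ ≤ B * w j) (M : ℕ) : ‖A - ∑ j ∈ Finset.range M, f j‖ ≤ B * ∑' j, w (j + M) := by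
  have h1 := hf.summable.sum_add_tsum_nat_add M
  rw [hf.tsum_eq] at h1
  rw [← h1, add_sub_cancel_left, ← tsum_mul_left]
  exact tsum_of_norm_bounded (((summable_nat_add_iff M).2 hw).mul_left B).hasSum (fun j => h _)

open Filter Asymptotics

lemma lp_sum_apply {n : ℕ} (c : Fin n → ℂ) (u : Fin n → lp (fun _ : ℕ => ℂ) 2) (j : ℕ) :
    (∑ k, c k • u k : lp (fun _ : ℕ => ℂ) 2) j = ∑ k, c k * u k j := by
  let f : lp (fun _ : ℕ => ℂ) 2 →+ ℂ :=
    { toFun := fun x => x j, map_zero' := rfl, map_add' := fun x y => rfl }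
  exact map_sum f _ _

lemma lower_core (m : ℕ) (d : ℕ → ℝ) (a : ℕ → ℕ → ℝ) (hsa : StandingAssumptions m d a)
    (lam : ℕ → ℝ) (v : ℕ → lp (fun _ : ℕ => ℂ) 2)
    (heig : IsEigenSystem m d a lam v) (C δ : ℝ) (hC : 0 ≤ C)
    (hα : ∀ i j, |kern 1 m a i j| ≤ C * wt i ^ δ) (n : ℕ) :
    ∃ ε : ℕ → ℝ, Tendsto ε atTop (nhds 0) ∧ ∃ H : ℝ, 0 ≤ H ∧ ∀ (M : ℕ) (S : (ℕ → ℂ) →ₗ[ℂ] (Fin n → ℂ)),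
      ∃ (x : ℕ → ℂ) (N : ℝ), 0 < N ∧ S x = 0 ∧ Qf d (kern 1 m a) M x ≤ (lam n + ε M) * N ∧
        |N - ∑ i ∈ Finset.range M, ‖x i‖ ^ 2| ≤ ε M * N ∧
        ∑ i ∈ Finset.range M, wt i ^ (δ+1) * ‖x i‖ ^ 2 ≤ H * N := by
  obtain ⟨ho, hsp, hmono, -, hev⟩ := heig
  have hv1 : ∀ k j, ‖v k j‖ ≤ 1 := fun k j => by
    have := lp.norm_apply_le_norm (by norm_num) (v k) j
    rwa [ho.1 k] at this
  have hdec : ∀ (k : ℕ) (p : ℝ), Summable fun j => wt j ^ p * ‖v k j‖ := fun k p =>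
    decay_sum m d a hsa (lam k) (v k) (hv1 k) (hev k) p
  let w : ℕ → ℝ := fun j => ∑ k : Fin (n+1), ‖v k j‖
  have hw0 : ∀ j, 0 ≤ w j := fun j => Finset.sum_nonneg fun _ _ => norm_nonneg _
  have hwW : ∀ j, w j ≤ (n:ℝ) + 1 := fun j => by
    calc w j ≤ ∑ k : Fin (n+1), (1:ℝ) := Finset.sum_le_sum fun k _ => hv1 k j
      _ = _ := by simp
  have hws : ∀ p : ℝ, Summable fun j => wt j ^ p * w j := fun p => by
    have : (fun j => wt j ^ p * w j) = fun j => ∑ k : Fin (n+1), wt j ^ p * ‖v k j‖ := by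
      funext j; simp only [w]; rw [Finset.mul_sum]
    rw [this]
    exact summable_sum fun k _ => hdec k p
  have hws0 : Summable w := by simpa using hws 0
  let Λ : ℝ := ∑ k : Fin (n+1), |lam k|
  have hΛ : ∀ k : Fin (n+1), |lam k| ≤ Λ := fun k =>
    Finset.single_le_sum (f := fun k : Fin (n+1) => |lam k|) (fun _ _ => abs_nonneg _) (Finset.mem_univ k)
  have hΛ0 : 0 ≤ Λ := Finset.sum_nonneg fun _ _ => abs_nonneg _
  let e : ℕ → ℝ := fun M => ∑' j, w (j + M)
  have he0 : ∀ M, 0 ≤ e M := fun M => tsum_nonneg fun _ => hw0 _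
  let Sδ : ℝ := ∑' j, wt j ^ δ * w j
  have hSδ : 0 ≤ Sδ := tsum_nonneg fun j => mul_nonneg (wtp_pos _ _).le (hw0 _)
  let W : ℝ := (n:ℝ) + 1
  have hW : 0 ≤ W := by positivity
  refine ⟨fun M => (C * Sδ + Λ * W + W) * e M, ?_, (∑' j, wt j ^ (δ+1) * w j) * W, ?_, fun M S => ?_⟩
  · have := (tendsto_sum_nat_add w).const_mul (C * Sδ + Λ * W + W)
    simpa using this
  · exact mul_nonneg (tsum_nonneg fun j => mul_nonneg (wtp_pos _ _).le (hw0 _)) hW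
  let Φ : (Fin (n+1) → ℂ) →ₗ[ℂ] (ℕ → ℂ) :=
    { toFun := fun c j => ∑ k : Fin (n+1), c k * v k j
      map_add' := fun c c' => by funext j; simp [add_mul, Finset.sum_add_distrib]
      map_smul' := fun r c => by funext j; simp [Finset.mul_sum, mul_assoc] }
  have hL : LinearMap.ker (S ∘ₗ Φ) ≠ ⊥ := (S ∘ₗ Φ).ker_ne_bot_of_finrank_lt (by simp)
  obtain ⟨c, hc, hc0⟩ := (Submodule.ne_bot_iff _).1 hL
  let N : ℝ := ∑ k, ‖c k‖ ^ 2
  have hN : 0 < N := by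
    obtain ⟨k, hk⟩ := Function.ne_iff.1 hc0
    refine lt_of_lt_of_le (pow_pos (norm_pos_iff.2 hk) 2) ?_
    exact Finset.single_le_sum (f := fun k => ‖c k‖ ^ 2) (fun i _ => by positivity) (Finset.mem_univ k)
  let s := Real.sqrt N
  have hs0 : 0 ≤ s := Real.sqrt_nonneg _
  have hs : s * s = N := Real.mul_self_sqrt hN.le
  have hck : ∀ k, ‖c k‖ ≤ s := fun k => Real.le_sqrt_of_sq_le
    (Finset.single_le_sum (f := fun k => ‖c k‖ ^ 2) (fun i _ => by positivity) (Finset.mem_univ k))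
  let x : ℕ → ℂ := fun j => ∑ k : Fin (n+1), c k * v k j
  let g : ℕ → ℂ := fun j => ∑ k : Fin (n+1), (c k * lam k) * v k j
  have hxw : ∀ j, ‖x j‖ ≤ s * w j := fun j => by
    simp only [x, w]
    rw [Finset.mul_sum]
    refine (norm_sum_le _ _).trans (Finset.sum_le_sum fun k _ => ?_)
    rw [norm_mul]
    exact mul_le_mul_of_nonneg_right (hck k) (norm_nonneg _)
  have hgw : ∀ j, ‖g j‖ ≤ s * Λ * w j := fun j => by
    simp only [g, w]
    rw [Finset.mul_sum]
    refine (norm_sum_le _ _).trans (Finset.sum_le_sum fun k _ => ?_)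
    rw [norm_mul, norm_mul, Complex.norm_real, Real.norm_eq_abs]
    exact mul_le_mul_of_nonneg_right (mul_le_mul (hck k) (hΛ k) (abs_nonneg _) hs0) (norm_nonneg _)
  have hgx : ∀ j, bandOp m d a x j = g j := by
    intro j
    have h1 : ∀ y : ℕ → ℂ, bandOp m d a y j = (d j : ℂ) * y j + ∑ i ∈ Finset.range (j+m+1), (kern 1 m a j i : ℂ) * y i := by
      intro y; unfold bandOp; rw [offDiag_kern m a y j (j+m+1) (fun i _ _ => by omega)]
    have h2 : ∀ k : Fin (n+1), (c k * lam k) * v k j = c k * ((d j : ℂ) * v k j + ∑ i ∈ Finset.range (j+m+1), (kern 1 m a j i : ℂ) * v k i) := by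
      intro k; rw [← h1, hev]; ring
    rw [h1]
    simp only [g, h2, mul_add, Finset.sum_add_distrib, x, Finset.mul_sum]
    congr 1
    · refine Finset.sum_congr rfl fun k _ => by ring
    · rw [Finset.sum_comm]
      refine Finset.sum_congr rfl fun k _ => Finset.sum_congr rfl fun i _ => by ring
  have hov : Orthonormal ℂ (fun k : Fin (n+1) => v k) := ho.comp _ Fin.val_injective
  let X : lp (fun _ : ℕ => ℂ) 2 := ∑ k : Fin (n+1), c k • v k
  let G : lp (fun _ : ℕ => ℂ) 2 := ∑ k : Fin (n+1), (c k * lam k) • v k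
  have hX : ∀ j, X j = x j := fun j => lp_sum_apply _ _ j
  have hG : ∀ j, G j = g j := fun j => lp_sum_apply _ _ j
  have hXX := lp.hasSum_inner (𝕜 := ℂ) X X
  have hXG := lp.hasSum_inner (𝕜 := ℂ) X G
  have e1 : inner ℂ X X = ((N:ℝ):ℂ) := by
    simp only [X]
    rw [hov.inner_sum c c Finset.univ]
    simp only [N]
    push_cast
    refine Finset.sum_congr rfl fun k _ => ?_
    rw [mul_comm, Complex.mul_conj, Complex.normSq_eq_norm_sq]; push_cast; rfl
  have e2 : inner ℂ X G = ((∑ k : Fin (n+1), lam k * ‖c k‖ ^ 2 : ℝ) : ℂ) := by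
    simp only [X, G]
    rw [hov.inner_sum c (fun k => c k * lam k) Finset.univ]
    push_cast
    refine Finset.sum_congr rfl fun k _ => ?_
    rw [← mul_assoc, mul_comm _ (c k), Complex.mul_conj, Complex.normSq_eq_norm_sq]; push_cast; ring
  rw [e1] at hXX
  rw [e2] at hXG
  simp only [RCLike.inner_apply, hX, hG] at hXX hXG
  have t1 := tail_bd (B := N * W) hXX hws0 (fun j => by
    rw [norm_mul, RCLike.norm_conj]
    calc _ ≤ (s * w j) * (s * w j) := mul_le_mul (hxw j) (hxw j) (norm_nonneg _) (mul_nonneg hs0 (hw0 j))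
      _ = N * w j * w j := by rw [← hs]; ring
      _ ≤ N * W * w j := by
        have := hw0 j
        have := hwW j
        gcongr) M
  have t2 := tail_bd (B := N * (Λ * W)) hXG hws0 (fun j => by
    rw [norm_mul, RCLike.norm_conj]
    calc _ ≤ (s * Λ * w j) * (s * w j) := mul_le_mul (hgw j) (hxw j) (norm_nonneg _) (by have := hw0 j; positivity)
      _ = N * (Λ * w j) * w j := by rw [← hs]; ring
      _ ≤ N * (Λ * W) * w j := by
        have := hw0 j
        have := hwW j
        gcongr) M
  have heM := he0 M
  refine ⟨x, N, hN, LinearMap.mem_ker.1 hc, ?_, ?_, ?_⟩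
  · have hin : ∀ j ∈ Finset.range M, (d j : ℂ) * x j + ∑ i ∈ Finset.range M, (kern 1 m a j i : ℂ) * x i
        = g j - ∑ i ∈ Finset.range (m+1), (kern 1 m a j (M+i) : ℂ) * x (M+i) := by
      intro j hj
      rw [Finset.mem_range] at hj
      rw [← hgx]; unfold bandOp
      rw [offDiag_kern m a x j (M+(m+1)) (fun i _ _ => by omega), Finset.sum_range_add]; ring
    have hcomplex := Qf_complex m d a M x
    have hb : ∀ j, ‖∑ i ∈ Finset.range (m+1), (kern 1 m a j (M+i) : ℂ) * x (M+i)‖ ≤ C * wt j ^ δ * (s * e M) := by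
      intro j
      have hwj := wtp_pos j δ
      calc _ ≤ ∑ i ∈ Finset.range (m+1), (C * wt j ^ δ * s) * w (i + M) := by
            refine (norm_sum_le _ _).trans (Finset.sum_le_sum fun i _ => ?_)
            rw [norm_mul, Complex.norm_real, Real.norm_eq_abs, mul_assoc (C * wt j ^ δ), add_comm i M]
            exact mul_le_mul (hα _ _) (hxw _) (norm_nonneg _) (by positivity)
        _ = (C * wt j ^ δ * s) * ∑ i ∈ Finset.range (m+1), w (i + M) := by rw [Finset.mul_sum]
        _ ≤ (C * wt j ^ δ * s) * e M := by
            refine mul_le_mul_of_nonneg_left ?_ (by positivity)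
            exact ((summable_nat_add_iff M).2 hws0).sum_le_tsum _ (fun _ _ => hw0 _)
        _ = _ := by ring
    have hB : ‖∑ j ∈ Finset.range M, (starRingEnd ℂ (x j)) * ∑ i ∈ Finset.range (m+1), (kern 1 m a j (M+i) : ℂ) * x (M+i)‖ ≤ N * (C * Sδ) * e M := by
      calc _ ≤ ∑ j ∈ Finset.range M, (N * C * e M) * (wt j ^ δ * w j) := by
            refine (norm_sum_le _ _).trans (Finset.sum_le_sum fun j _ => ?_)
            rw [norm_mul, RCLike.norm_conj]
            have := hw0 j
            calc _ ≤ (s * w j) * (C * wt j ^ δ * (s * e M)) := mul_le_mul (hxw j) (hb j) (norm_nonneg _) (by positivity)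
              _ = _ := by rw [← hs]; ring
        _ = (N * C * e M) * ∑ j ∈ Finset.range M, (wt j ^ δ * w j) := by rw [Finset.mul_sum]
        _ ≤ (N * C * e M) * Sδ := by
            refine mul_le_mul_of_nonneg_left ?_ (by positivity)
            exact (hws δ).sum_le_tsum _ (fun _ _ => mul_nonneg (wtp_pos _ _).le (hw0 _))
        _ = _ := by ring
    rw [Finset.sum_congr rfl fun j hj => by rw [hin j hj, mul_sub], Finset.sum_sub_distrib, Complex.sub_re] at hcomplex
    have r1 := (Complex.abs_re_le_norm _).trans hB
    have r2 := (Complex.abs_re_le_norm _).trans t2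
    rw [Complex.sub_re, Complex.ofReal_re] at r2
    have r3 : ∑ j ∈ Finset.range M, (starRingEnd ℂ (x j)) * g j = ∑ j ∈ Finset.range M, g j * (starRingEnd ℂ (x j)) :=
      Finset.sum_congr rfl fun j _ => mul_comm _ _
    rw [r3] at hcomplex
    have r4 : ∑ k : Fin (n+1), lam k * ‖c k‖ ^ 2 ≤ lam n * N := by
      simp only [N]; rw [Finset.mul_sum]
      refine Finset.sum_le_sum fun k _ => mul_le_mul_of_nonneg_right (hmono (by omega)) (by positivity)
    have r5 := (abs_le.1 r1).1
    have r6 := (abs_le.1 r2).1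
    have r7 : 0 ≤ W * e M * N := by positivity
    rw [← hcomplex]
    change _ ≤ (lam n + (C * Sδ + Λ * W + W) * e M) * N
    change - (N * (Λ * W) * e M) ≤ _ at r6
    nlinarith [r4, r5, r6, r7]
  · have r2 := (Complex.abs_re_le_norm _).trans t1
    rw [Complex.sub_re, Complex.ofReal_re, Complex.re_sum] at r2
    have r3 : ∀ j, (x j * (starRingEnd ℂ (x j))).re = ‖x j‖ ^ 2 := fun j => by rw [cnorm]; simp; ring
    simp only [r3] at r2
    refine r2.trans ?_
    change N * W * e M ≤ (C * Sδ + Λ * W + W) * e M * N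
    have q1 : 0 ≤ (C * Sδ) * e M * N := by positivity
    have q2 : 0 ≤ (Λ * W) * e M * N := by positivity
    linarith
  · calc _ ≤ ∑ i ∈ Finset.range M, (N * W) * (wt i ^ (δ+1) * w i) := by
          refine Finset.sum_le_sum fun i _ => ?_
          have h1 : ‖x i‖ ^ 2 ≤ (s * w i) ^ 2 := pow_le_pow_left₀ (norm_nonneg _) (hxw i) 2
          have h2 : (s * w i) ^ 2 = N * (w i * w i) := by rw [← hs]; ring
          have h3 : w i * w i ≤ W * w i := mul_le_mul_of_nonneg_right (hwW i) (hw0 i)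
          have h4 : ‖x i‖ ^ 2 ≤ N * (W * w i) := by rw [h2] at h1; exact h1.trans (mul_le_mul_of_nonneg_left h3 hN.le)
          calc _ ≤ wt i ^ (δ+1) * (N * (W * w i)) := mul_le_mul_of_nonneg_left h4 (wtp_pos _ _).le
            _ = _ := by ring
      _ = (N * W) * ∑ i ∈ Finset.range M, (wt i ^ (δ+1) * w i) := by rw [Finset.mul_sum]
      _ ≤ (N * W) * ∑' j, wt j ^ (δ+1) * w j := by
          refine mul_le_mul_of_nonneg_left ?_ (by positivity)
          exact (hws (δ+1)).sum_le_tsum _ (fun _ _ => mul_nonneg (wtp_pos _ _).le (hw0 _))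
      _ = _ := by ring

open Filter Asymptotics

lemma kern_res (m : ℕ) (d : ℕ → ℝ) (a b : ℕ → ℕ → ℝ) (i j : ℕ) :
    kern 1 m a i j + kern (-1) m b i j * (d i - d j) =
      kern 1 m (fun l n => a l n - b l n * (d (n+l) - d n)) i j := by
  unfold kern
  rw [Finset.sum_mul, ← Finset.sum_add_distrib]
  refine Finset.sum_congr rfl fun l hl => ?_
  have := (Finset.mem_Icc.1 hl).1
  by_cases h1 : j = i + l
  · have h2 : ¬ i = j + l := by omega
    subst h1
    simp only [if_true, if_neg h2]; ring
  · by_cases h2 : i = j + l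
    · subst h2
      simp only [if_true, if_neg h1]; ring
    · simp only [if_neg h1, if_neg h2]; ring

lemma incr_ev {d : ℕ → ℝ} {δ₀ b μ : ℝ} (hb : 0 < b) (hμ : μ < δ₀)
    (h : ∀ᶠ n in atTop, b * wt n ^ (δ₀-1) ≤ d (n+1) - d n) (C : ℝ) :
    ∃ n₀, ∀ i j, n₀ ≤ i → i ≤ j → d i + C * wt i ^ μ ≤ d j + C * wt j ^ μ := by
  have h1 := ((symb_wt μ).2.trans_isLittleO (littleO_wt (show μ - 1 < δ₀ - 1 by linarith))).const_mul_left C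
  obtain ⟨n₀, hn⟩ := eventually_atTop.1 (h.and (h1.bound hb))
  refine ⟨n₀, fun i j hi hij => ?_⟩
  induction j, hij using Nat.le_induction with
  | base => exact le_rfl
  | succ j hj ih =>
    obtain ⟨e1, e2⟩ := hn j (hi.trans hj)
    rw [Real.norm_eq_abs, Real.norm_of_nonneg (wtp_pos _ _).le] at e2
    have := (abs_le.1 e2).1
    linarith

lemma max_ev {f : ℕ → ℝ} (hf : Tendsto f atTop atTop) (n₀ : ℕ) (h : ∀ i j, n₀ ≤ i → i ≤ j → f i ≤ f j) :
    ∀ᶠ n in atTop, ∀ j ≤ n, f j ≤ f n := by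
  have h1 : ∀ᶠ n in atTop, ∀ j ∈ Finset.range n₀, f j ≤ f n :=
    (Finset.eventually_all _).2 fun j _ => hf.eventually_ge_atTop (f j)
  filter_upwards [h1] with n hn j hj
  by_cases hjn : j < n₀
  · exact hn j (Finset.mem_range.2 hjn)
  · exact h j n (by omega) hj

open Filter Asymptotics

lemma up_lim {l B X : ℝ} {n : ℕ} (h : ∀ K : ℕ, n + 1 ≤ K → l ≤ B + X / K) : l ≤ B := by
  have h1 : Tendsto (fun K : ℕ => B + X / K) atTop (nhds (B + 0)) :=
    tendsto_const_nhds.add (tendsto_const_div_atTop_nhds_zero_nat X)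
  rw [add_zero] at h1
  exact ge_of_tendsto h1 ((eventually_ge_atTop (n+1)).mono h)

theorem main_theorem
    (m : ℕ) (d : ℕ → ℝ) (a : ℕ → ℕ → ℝ)
    (hsa : StandingAssumptions m d a)
    (lam : ℕ → ℝ) (v : ℕ → lp (fun _ : ℕ => ℂ) 2)
    (heig : IsEigenSystem m d a lam v)
    (cl δl : ℕ → ℝ) (δ c₀ c δ₀ : ℝ)
    (hδ : ∀ l ∈ Finset.Icc 1 m, δl l ≤ δ)
    (ha : ∀ l ∈ Finset.Icc 1 m,
      (fun n : ℕ => a l n - cl l * (n : ℝ) ^ (δl l))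
        =O[atTop] fun n : ℕ => (n : ℝ) ^ (δ - 1))
    (hδ₀ : 0 < δ₀) (hc₀ : 0 < c₀)
    (hd : (fun n : ℕ => d n - (c₀ * (n : ℝ) ^ δ₀ + c * (n : ℝ) ^ (δ₀ - 1)))
      =O[atTop] fun n : ℕ => (n : ℝ) ^ (δ₀ - 2))
    (hκ : 0 < δ₀ - δ) :
    (fun n : ℕ => lam n - d n) =O[atTop] fun n : ℕ => (n : ℝ) ^ (δ - (δ₀ - δ)) := by
  obtain ⟨b₀, hb₀, hlow⟩ := d1_lower hδ₀ hc₀ hd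
  have hd1 := d1_symb hd
  let b : ℕ → ℕ → ℝ := fun l n => a l n * (d (n+l) - d n)⁻¹
  have hA : ∀ l ∈ Finset.Icc 1 m, Symb δ (a l) := fun l hl => a_symb (hδ l hl) (ha l hl)
  have hb : ∀ l ∈ Finset.Icc 1 m, Symb (1 - (δ₀ - δ)) (b l) := fun l hl => by
    have hl1 := (Finset.mem_Icc.1 hl).1
    have := (hA l hl).mul ((dl_symb hd1 l hl1).inv hb₀ (dl_lower hb₀ hlow l hl1))
    rwa [show δ + -(δ₀ - 1) = 1 - (δ₀ - δ) by ring] at this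
  have hr : ∀ l ∈ Finset.Icc 1 m, Symb (δ - (δ₀ - δ)) ((fun l n => a l n - b l n * (d (n+l) - d n)) l) := fun l hl => by
    have hl1 := (Finset.mem_Icc.1 hl).1
    refine Symb.of_small (IsBigO.of_bound 0 ?_)
    filter_upwards [dl_lower hb₀ hlow l hl1] with n hn
    have hp : 0 < d (n+l) - d n := (mul_pos hb₀ (wtp_pos n _)).trans_le hn
    simp only [b]
    rw [mul_assoc, inv_mul_cancel₀ hp.ne']; simp
  obtain ⟨C1, hC1, k1⟩ := kern_KS 1 (by simp) m δ a hA
  obtain ⟨C2, hC2, k2⟩ := kern_KS (-1) (by simp) m _ b hb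
  obtain ⟨C3, hC3, k3⟩ := kern_KS 1 (by simp) m _ _ hr
  obtain ⟨C, hC, hU⟩ := fin_real m δ (δ₀ - δ) hκ d (kern 1 m a) (kern (-1) m b) (C1+C2+C3) (by positivity)
    (k1.mono (by linarith)) (k2.mono (by linarith)) (kern_symm m a) (kern_anti m b)
    (fun i j => by rw [kern_res]; exact (k3.mono (by linarith)).size i j)
  have hμ : δ - (δ₀ - δ) < δ₀ := by linarith
  obtain ⟨n1, hn1⟩ := incr_ev hb₀ hμ hlow C
  obtain ⟨n2, hn2⟩ := incr_ev hb₀ hμ hlow (-C)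
  have ht : Tendsto (fun n => d n + C * wt n ^ (δ - (δ₀ - δ))) atTop atTop :=
    tendsto_atTop_mono (fun n => by have := mul_nonneg hC (wtp_pos n (δ - (δ₀ - δ))).le; linarith) hsa.2
  have hmax := max_ev ht n1 hn1
  refine IsBigO.trans (IsBigO.of_bound C ?_) (isBigO_wt_cast (δ - (δ₀ - δ)))
  filter_upwards [hmax, eventually_ge_atTop n2] with n hnm hn2'
  rw [Real.norm_eq_abs, Real.norm_of_nonneg (wtp_pos _ _).le, abs_le]
  constructor
  · suffices h : d n - C * wt n ^ (δ - (δ₀ - δ)) ≤ lam n by linarith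
    set B := d n - C * wt n ^ (δ - (δ₀ - δ)) with hB
    obtain ⟨ε, hε, H, hH, hlc⟩ := lower_core m d a hsa lam v heig C1 δ hC1 k1.size n
    have key : ∀ K : ℕ, n + 1 ≤ K → B ≤ lam n + ε (2*K) + |B| * ε (2*K) + C * H / K := by
      intro K hK
      have hK0 : (0:ℝ) < K := by exact_mod_cast (by omega : 0 < K)
      obtain ⟨U, hUK⟩ := hU K (by omega)
      obtain ⟨S, hS⟩ := low_fin δ (δ₀ - δ) d (kern 1 m a) C K U hUK n (by omega) B
        (fun j hj => by have := hn2 n j hn2' hj; rw [hB]; linarith)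
      obtain ⟨x, N, hN, hx, h1, h2, h3⟩ := hlc (2*K) S
      have h4 := hS x hx
      set Sg := ∑ i ∈ Finset.range (2*K), ‖x i‖ ^ 2
      have h5 : B * (N - Sg) ≤ |B| * (ε (2*K) * N) :=
        (le_abs_self _).trans (by rw [abs_mul]; exact mul_le_mul_of_nonneg_left h2 (abs_nonneg _))
      have h6 : C / K * ∑ i ∈ Finset.range (2*K), wt i ^ (δ+1) * ‖x i‖ ^ 2 ≤ C / K * (H * N) :=
        mul_le_mul_of_nonneg_left h3 (by positivity)
      have h7 : C / K * (H * N) = C * H / K * N := by ring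
      refine le_of_mul_le_mul_right ?_ hN
      nlinarith [h1, h4, h5, h6, h7]
    have h2K : Tendsto (fun K : ℕ => ε (2*K)) atTop (nhds 0) :=
      hε.comp (tendsto_atTop_mono (fun K => show K ≤ 2 * K by omega) tendsto_id)
    have hlim : Tendsto (fun K : ℕ => lam n + ε (2*K) + |B| * ε (2*K) + C * H / K) atTop (nhds (lam n + 0 + |B| * 0 + 0)) :=
      ((tendsto_const_nhds.add h2K).add (h2K.const_mul _)).add (tendsto_const_div_atTop_nhds_zero_nat _)
    have := ge_of_tendsto hlim ((eventually_ge_atTop (n+1)).mono key)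
    simpa using this
  · suffices h : lam n ≤ d n + C * wt n ^ (δ - (δ₀ - δ)) by linarith
    refine up_lim (n := n) (X := C * C * ∑ i ∈ Finset.range (n+1), wt i ^ (δ + 1)) fun K hK => ?_
    obtain ⟨U, hUK⟩ := hU K (by omega)
    obtain ⟨T, hT⟩ := up_fin δ (δ₀ - δ) d (kern 1 m a) C hC K U hUK n (by omega) _ hnm
    obtain ⟨y, hy, h1⟩ := upper_core m d a lam v heig n (2*K) T (fun y => (hT y).1)
    obtain ⟨-, h2, h3⟩ := hT y
    rw [h2] at h1
    have hN : 0 < ∑ i, ‖y i‖ ^ 2 := by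
      obtain ⟨k, hk⟩ := Function.ne_iff.1 hy
      refine lt_of_lt_of_le (pow_pos (norm_pos_iff.2 hk) 2) ?_
      exact Finset.single_le_sum (f := fun k => ‖y k‖ ^ 2) (fun i _ => by positivity) (Finset.mem_univ k)
    have := le_of_mul_le_mul_right (h1.trans h3) hN
    rw [mul_div_right_comm]; exact this
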